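/- arXiv:2412.17658 — 3 statements merged into one kernel-verified Lean document; each statement's English description precedes it below -/
import Mathlib

section
/- Let S, Z, W be random variables on finite alphabets with joint distribution P_{S,Z,W}, where Z plays the role of the semantic f(X) and W the role of the task h(X), H(S) > 0, and let ε satisfy 0 ≤ ε ≤ H(S); set α = ε/H(S). Then there exists a random variable U, jointly distributed with (S,Z,W) and generated from (S,Z), such that I(U;S) = ε and I(U;W) ≥ L^2(ε) := H(Z|S) − α·H(S|Z) + ε − (1−α)·(log(I(S;Z)+1) + 4) − H(Z|W). (Second lower bound on utility in Theorem 1.) -/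
open MeasureTheory ProbabilityTheory

/-- Shannon entropy (natural logarithm) of a random variable `X`
taking values in a finite alphabet `α`. -/
noncomputable def infH {Ω : Type*} [MeasurableSpace Ω] {α : Type*} [Fintype α]
    (P : Measure Ω) (X : Ω → α) : ℝ :=
  ∑ a : α, Real.negMulLog (P (X ⁻¹' {a})).toReal

/-- Conditional Shannon entropy `H(X | Y)`. -/
noncomputable def infCondH {Ω : Type*} [MeasurableSpace Ω] {α β : Type*} [Fintype α] [Fintype β]
    (P : Measure Ω) (X : Ω → α) (Y : Ω → β) : ℝ :=
  infH P (fun ω => (X ω, Y ω)) - infH P Y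

/-- Mutual information `I(X ; Y)`. -/
noncomputable def infMI {Ω : Type*} [MeasurableSpace Ω] {α β : Type*} [Fintype α] [Fintype β]
    (P : Measure Ω) (X : Ω → α) (Y : Ω → β) : ℝ :=
  infH P X + infH P Y - infH P (fun ω => (X ω, Y ω))

/-- Conditional mutual information `I(X ; Y | Z)`. -/
noncomputable def infCMI {Ω : Type*} [MeasurableSpace Ω] {α β γ : Type*}
    [Fintype α] [Fintype β] [Fintype γ]
    (P : Measure Ω) (X : Ω → α) (Y : Ω → β) (Z : Ω → γ) : ℝ :=
  infCondH P X Z + infCondH P Y Z - infCondH P (fun ω => (X ω, Y ω)) Z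


/-- The standard exponential distribution on `ℝ`. -/
noncomputable def stdExp : Measure ℝ :=
  (volume.restrict (Set.Ioi 0)).withDensity fun x => ENNReal.ofReal (Real.exp (-x))

lemma lintegral_stdExp {f : ℝ → ENNReal} (hf : Measurable f) :
    ∫⁻ x, f x ∂stdExp = ∫⁻ x in Set.Ioi 0, ENNReal.ofReal (Real.exp (-x)) * f x := by
  rw [stdExp, lintegral_withDensity_eq_lintegral_mul _ (by fun_prop) hf]
  rfl

lemma stdExp_Ioi {t : ℝ} (ht : 0 ≤ t) : stdExp (Set.Ioi t) = ENNReal.ofReal (Real.exp (-t)) := by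
  rw [stdExp, withDensity_apply _ measurableSet_Ioi, Measure.restrict_restrict measurableSet_Ioi,
    Set.inter_eq_left.2 (Set.Ioi_subset_Ioi ht), ← integral_exp_neg_Ioi t,
    ofReal_integral_eq_lintegral_ofReal]
  · simpa [IntegrableOn] using integrableOn_exp_mul_Ioi (a := -1) (by norm_num) t
  · exact Filter.Eventually.of_forall fun x => (Real.exp_pos _).le

lemma ae_stdExp_pos : ∀ᵐ x ∂stdExp, 0 < x :=
  (withDensity_absolutelyContinuous _ _).ae_le (ae_restrict_mem measurableSet_Ioi)

instance isProbabilityMeasure_stdExp : IsProbabilityMeasure stdExp where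
  measure_univ := by
    rw [← measure_congr (s := Set.Ioi 0), stdExp_Ioi le_rfl]
    · simp
    · exact Filter.eventuallyEq_univ.2 ae_stdExp_pos

section Race

variable {ζ : Type*}

/-- The event that `z` wins the race in which `i` finishes at time `e i / p i`. -/
def raceWin (p : ζ → ℝ) (z : ζ) : Set (ζ → ℝ) :=
  {e | ∀ i, i ≠ z → p i * e z < p z * e i}

lemma disjoint_raceWin (p : ζ → ℝ) {z z' : ζ} {e : ζ → ℝ} (h : e ∈ raceWin p z)
    (h' : e ∈ raceWin p z') : z = z' := by
  by_contra hne
  have h1 := h z' (Ne.symm hne)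
  have h2 := h' z hne
  linarith

variable [Fintype ζ]

lemma measurableSet_raceWin (p : ζ → ℝ) (z : ζ) : MeasurableSet (raceWin p z) := by
  simp only [raceWin, Set.ofPred_forall]
  exact MeasurableSet.iInter fun i => MeasurableSet.iInter fun _ =>
    measurableSet_lt (by fun_prop) (by fun_prop)

lemma lintegral_raceWin {p : ζ → ℝ} (hp : ∀ i, 0 ≤ p i) (hsum : ∑ i, p i = 1) {z : ζ}
    (hz : 0 < p z) {φ : ℝ → ENNReal} (hφ : Measurable φ) :
    ∫⁻ e in raceWin p z, φ (e z) ∂(Measure.pi fun _ : ζ => stdExp)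
      = ∫⁻ x in Set.Ioi 0, φ x * ENNReal.ofReal (Real.exp (-(p z)⁻¹ * x)) := by
  classical
  rw [← lintegral_indicator (measurableSet_raceWin p z)]
  have hF : Measurable ((raceWin p z).indicator fun e : ζ → ℝ => φ (e z)) :=
    (hφ.comp (measurable_pi_apply z)).indicator (measurableSet_raceWin p z)
  rw [lintegral_eq_lmarginal_univ (0 : ζ → ℝ), lmarginal_erase _ hF (Finset.mem_univ z)]
  have inner : ∀ t : ℝ, 0 < t →
      (∫⋯∫⁻_Finset.univ.erase z, (raceWin p z).indicator fun e : ζ → ℝ => φ (e z)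
        ∂fun _ => stdExp) (Function.update 0 z t)
        = φ t * ENNReal.ofReal (Real.exp (-((p z)⁻¹ - 1) * t)) := by
    intro t ht
    rw [lmarginal]
    have : ∀ y : (i : (Finset.univ.erase z : Finset ζ)) → ℝ,
        (raceWin p z).indicator (fun e : ζ → ℝ => φ (e z))
          (Function.updateFinset (Function.update 0 z t) (Finset.univ.erase z) y)
        = (Set.univ.pi fun i : (Finset.univ.erase z : Finset ζ) =>
            Set.Ioi (p i / p z * t)).indicator (fun _ => φ t) y := by
      intro y
      have hval : Function.updateFinset (Function.update (0 : ζ → ℝ) z t) (Finset.univ.erase z) y z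
          = t := by simp [Function.updateFinset]
      simp only [Set.indicator, hval]
      congr 1
      rw [raceWin, Set.mem_ofPred_eq, hval, Set.mem_univ_pi, eq_iff_iff]
      constructor
      · intro h i
        have hi : (i : ζ) ≠ z := Finset.ne_of_mem_erase i.2
        have := h i hi
        simp only [Function.updateFinset, i.2, dif_pos] at this
        rw [Set.mem_Ioi, div_mul_eq_mul_div, div_lt_iff₀ hz]
        linarith
      · intro h i hi
        have := h ⟨i, by simp [hi]⟩
        rw [Set.mem_Ioi, div_mul_eq_mul_div, div_lt_iff₀ hz] at this
        simp only [Function.updateFinset, Finset.mem_erase, ne_eq, hi, not_false_eq_true,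
          Finset.mem_univ, and_self, dif_pos]
        linarith
    simp only [this]
    rw [lintegral_indicator_const (MeasurableSet.univ_pi fun _ => measurableSet_Ioi),
      Measure.pi_pi]
    congr 1
    rw [Finset.prod_congr rfl fun i _ => stdExp_Ioi (by have := hp i; positivity),
      ← ENNReal.ofReal_prod_of_nonneg fun _ _ => (Real.exp_pos _).le, ← Real.exp_sum]
    congr 2
    rw [Finset.sum_neg_distrib, ← Finset.sum_mul, ← Finset.sum_div,
      Finset.sum_coe_sort (Finset.univ.erase z) p, Finset.sum_erase_eq_sub (Finset.mem_univ z), hsum]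
    field_simp
  rw [lintegral_congr_ae (ae_stdExp_pos.mono inner), lintegral_stdExp (by fun_prop)]
  refine lintegral_congr fun x => ?_
  rw [mul_left_comm, ← ENNReal.ofReal_mul (Real.exp_pos _).le, ← Real.exp_add]
  congr 3
  ring

lemma measureReal_raceWin {p : ζ → ℝ} (hp : ∀ i, 0 ≤ p i) (hsum : ∑ i, p i = 1) {z : ζ}
    (hz : 0 < p z) : (Measure.pi fun _ : ζ => stdExp).real (raceWin p z) = p z := by
  have h := lintegral_raceWin hp hsum hz (φ := fun _ => 1) measurable_const
  have hneg : -(p z)⁻¹ < 0 := by simpa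
  simp only [lintegral_one, Measure.restrict_apply_univ, one_mul] at h
  rw [← ofReal_integral_eq_lintegral_ofReal (integrableOn_exp_mul_Ioi hneg 0)
    (Filter.Eventually.of_forall fun x => (Real.exp_pos _).le), integral_exp_mul_Ioi hneg] at h
  rw [Measure.real, h, ENNReal.toReal_ofReal] <;> simp [hz.le]

lemma setLIntegral_raceWin {p : ζ → ℝ} (hp : ∀ i, 0 ≤ p i) (hsum : ∑ i, p i = 1) {z : ζ}
    (hz : 0 < p z) :
    ∫⁻ e in raceWin p z, ENNReal.ofReal (e z) ∂(Measure.pi fun _ : ζ => stdExp)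
      = ENNReal.ofReal (p z ^ 2) := by
  rw [lintegral_raceWin hp hsum hz ENNReal.measurable_ofReal]
  have hG := Real.integral_rpow_mul_exp_neg_mul_Ioi (a := 2) (r := (p z)⁻¹) (by norm_num)
    (inv_pos.2 hz)
  have hG' : ∫ x in Set.Ioi 0, x * Real.exp (-(p z)⁻¹ * x) = p z ^ 2 := by
    norm_num at hG
    simpa using hG
  rw [← hG', ofReal_integral_eq_lintegral_ofReal]
  · refine setLIntegral_congr_fun measurableSet_Ioi fun x hx => ?_
    exact (ENNReal.ofReal_mul (le_of_lt hx)).symm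
  · by_contra hc
    rw [integral_undef hc] at hG'
    exact (pow_pos hz 2).ne hG'
  · filter_upwards [ae_restrict_mem measurableSet_Ioi] with x hx
    exact mul_nonneg (le_of_lt hx) (Real.exp_pos _).le

lemma pos_of_mem_raceWin {p : ζ → ℝ} (hp : ∀ i, 0 ≤ p i) (hsum : ∑ i, p i = 1) {z : ζ}
    {e : ζ → ℝ} (he : ∀ i, 0 < e i) (hwin : e ∈ raceWin p z) : 0 < p z := by
  by_cases h : ∃ i, i ≠ z
  · obtain ⟨i, hi⟩ := h
    have h1 := hwin i hi
    have h2 := mul_nonneg (hp i) (he z).le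
    exact (pos_iff_pos_of_mul_pos (h2.trans_lt h1)).2 (he i)
  · push Not at h
    rw [Fintype.sum_eq_single z fun i hi => absurd (h i) hi] at hsum
    exact hsum ▸ one_pos

lemma ae_pi_stdExp_forall_pos : ∀ᵐ e ∂(Measure.pi fun _ : ζ => stdExp), ∀ z, 0 < e z :=
  ae_all_iff.2 fun z =>
    (measurePreserving_eval (fun _ : ζ => stdExp) z).quasiMeasurePreserving.ae ae_stdExp_pos

lemma measure_raceWin_eq_zero {p : ζ → ℝ} (hp : ∀ i, 0 ≤ p i) (hsum : ∑ i, p i = 1) {z : ζ}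
    (hz : p z = 0) : (Measure.pi fun _ : ζ => stdExp) (raceWin p z) = 0 := by
  refine measure_eq_zero_iff_ae_notMem.2 (ae_pi_stdExp_forall_pos.mono fun e he hwin => ?_)
  exact (pos_of_mem_raceWin hp hsum he hwin).ne' hz

lemma measureReal_raceWin' {p : ζ → ℝ} (hp : ∀ i, 0 ≤ p i) (hsum : ∑ i, p i = 1) (z : ζ) :
    (Measure.pi fun _ : ζ => stdExp).real (raceWin p z) = p z := by
  rcases (hp z).eq_or_lt with hz | hz
  · rw [Measure.real, measure_raceWin_eq_zero hp hsum hz.symm, ← hz, ENNReal.toReal_zero]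
  · exact measureReal_raceWin hp hsum hz

lemma integrableOn_raceWin {p : ζ → ℝ} (hp : ∀ i, 0 ≤ p i) (hsum : ∑ i, p i = 1) (z : ζ) :
    IntegrableOn (fun e : ζ → ℝ => e z) (raceWin p z) (Measure.pi fun _ : ζ => stdExp) := by
  rcases (hp z).eq_or_lt with hz | hz
  · rw [IntegrableOn, Measure.restrict_eq_zero.2 (measure_raceWin_eq_zero hp hsum hz.symm)]
    exact integrable_zero_measure
  · refine ⟨(measurable_pi_apply z).aestronglyMeasurable, ?_⟩
    rw [hasFiniteIntegral_iff_ofReal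
      (ae_restrict_of_ae (ae_pi_stdExp_forall_pos.mono fun e he => (he z).le)),
      setLIntegral_raceWin hp hsum hz]
    exact ENNReal.ofReal_lt_top

lemma setIntegral_raceWin {p : ζ → ℝ} (hp : ∀ i, 0 ≤ p i) (hsum : ∑ i, p i = 1) (z : ζ) :
    ∫ e in raceWin p z, e z ∂(Measure.pi fun _ : ζ => stdExp) = p z ^ 2 := by
  rcases (hp z).eq_or_lt with hz | hz
  · rw [Measure.restrict_eq_zero.2 (measure_raceWin_eq_zero hp hsum hz.symm), ← hz]
    simp
  · rw [integral_eq_lintegral_of_nonneg_ae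
      (ae_restrict_of_ae (ae_pi_stdExp_forall_pos.mono fun e he => (he z).le))
      (measurable_pi_apply z).aestronglyMeasurable, setLIntegral_raceWin hp hsum hz,
      ENNReal.toReal_ofReal (sq_nonneg _)]

lemma ae_exists_mem_raceWin {p : ζ → ℝ} (hp : ∀ i, 0 ≤ p i) (hsum : ∑ i, p i = 1) :
    ∀ᵐ e ∂(Measure.pi fun _ : ζ => stdExp), ∃ z, e ∈ raceWin p z := by
  have hU : (Measure.pi fun _ : ζ => stdExp).real (⋃ z, raceWin p z) = 1 := by
    rw [measureReal_iUnion_fintype, ← hsum]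
    · exact Finset.sum_congr rfl fun z _ => measureReal_raceWin' hp hsum z
    · intro z z' hne
      exact Set.disjoint_left.2 fun e h h' => hne (disjoint_raceWin p h h')
    · exact measurableSet_raceWin p
  have hU' : (Measure.pi fun _ : ζ => stdExp) (⋃ z, raceWin p z) = 1 := by
    rwa [Measure.real, ENNReal.toReal_eq_one_iff] at hU
  filter_upwards [(mem_ae_iff_prob_eq_one (MeasurableSet.iUnion (measurableSet_raceWin p))).2 hU']
    with e he
  exact Set.mem_iUnion.1 he

open Classical in
/-- The winner of the race, with a fixed value on the null event of a draw. -/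
noncomputable def winner [Nonempty ζ] (p : ζ → ℝ) (e : ζ → ℝ) : ζ :=
  if h : ∃ z, e ∈ raceWin p z then h.choose else Classical.arbitrary ζ

lemma winner_eq_of_mem [Nonempty ζ] {p : ζ → ℝ} {z : ζ} {e : ζ → ℝ} (h : e ∈ raceWin p z) :
    winner p e = z := by
  have hex : ∃ z, e ∈ raceWin p z := ⟨z, h⟩
  rw [winner, dif_pos hex]
  exact disjoint_raceWin p hex.choose_spec h

lemma measurable_winner [Nonempty ζ] [MeasurableSpace ζ] (p : ζ → ℝ) :
    Measurable (winner p) := by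
  refine measurable_to_countable' fun z => ?_
  have hdraw : MeasurableSet (⋃ z, raceWin p z)ᶜ :=
    (MeasurableSet.iUnion (measurableSet_raceWin p)).compl
  by_cases hz : z = Classical.arbitrary ζ
  · convert! (measurableSet_raceWin p z).union hdraw using 1
    ext e
    simp only [Set.mem_preimage, Set.mem_singleton_iff, Set.mem_union, Set.mem_compl_iff,
      Set.mem_iUnion]
    constructor
    · intro h
      by_cases hex : ∃ z, e ∈ raceWin p z
      · obtain ⟨y, hy⟩ := hex
        rw [winner_eq_of_mem hy] at h
        exact Or.inl (h ▸ hy)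
      · exact Or.inr hex
    · rintro (h | h)
      · exact winner_eq_of_mem h
      · rw [winner, dif_neg h, hz]
  · convert! measurableSet_raceWin p z using 1
    ext e
    refine ⟨fun h => ?_, fun h => winner_eq_of_mem h⟩
    rw [Set.mem_preimage, Set.mem_singleton_iff] at h
    by_cases hex : ∃ z, e ∈ raceWin p z
    · obtain ⟨y, hy⟩ := hex
      rw [winner_eq_of_mem hy] at h
      exact h ▸ hy
    · rw [winner, dif_neg hex] at h
      exact absurd h.symm hz

lemma ae_winner_eq_iff [Nonempty ζ] {p : ζ → ℝ} (hp : ∀ i, 0 ≤ p i) (hsum : ∑ i, p i = 1) :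
    ∀ᵐ e ∂(Measure.pi fun _ : ζ => stdExp), ∀ z, winner p e = z ↔ e ∈ raceWin p z := by
  filter_upwards [ae_exists_mem_raceWin hp hsum] with e ⟨y, hy⟩ z
  refine ⟨fun h => ?_, winner_eq_of_mem⟩
  rw [winner_eq_of_mem hy] at h
  exact h ▸ hy

/-- A subprobability weight on the label with mass `P` that finishes at time `x / P`. -/
noncomputable def codeWeight (l P x : ℝ) : ℝ := l * (P / (P + x)) ^ (1 + l)

lemma codeWeight_nonneg {l P x : ℝ} (hl : 0 < l) (hP : 0 ≤ P) (hx : 0 ≤ x) :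
    0 ≤ codeWeight l P x := by
  unfold codeWeight; positivity

lemma codeWeight_le {l P x : ℝ} (hl : 0 < l) (hP : 0 ≤ P) (hx : 0 < x) :
    codeWeight l P x ≤ l := by
  have : P / (P + x) ≤ 1 := (div_le_one (by positivity)).2 (by linarith)
  exact mul_le_of_le_one_right hl.le (Real.rpow_le_one (by positivity) this (by positivity))

lemma neg_log_codeWeight_le {l P x r : ℝ} (hl : 0 < l) (hP : 0 < P) (hx : 0 < x) (hr : 0 ≤ r) :
    -Real.log (codeWeight l P x)
      ≤ -Real.log l + (1 + l) * (Real.log (1 + r) + (x / P - r) / (1 + r)) := by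
  have h1 : P / (P + x) = (1 + x / P)⁻¹ := by field_simp
  have h2 : 0 < 1 + x / P := by positivity
  have h3 : 0 < 1 + r := by positivity
  rw [codeWeight, h1, Real.log_mul hl.ne' (by positivity), Real.log_rpow (by positivity),
    Real.log_inv]
  have h4 := Real.log_le_sub_one_of_pos (div_pos h2 h3)
  rw [Real.log_div h2.ne' h3.ne'] at h4
  have h5 : (x / P - r) / (1 + r) = (1 + x / P) / (1 + r) - 1 := by field_simp; ring
  rw [h5]
  nlinarith

lemma measurable_codeWeight (l P : ℝ) : Measurable (codeWeight l P) := by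
  unfold codeWeight; fun_prop

lemma integrable_codeWeight {l P : ℝ} (hl : 0 < l) (hP : 0 ≤ P) :
    Integrable (codeWeight l P) stdExp := by
  refine Integrable.of_bound (measurable_codeWeight l P).aestronglyMeasurable l
    (ae_stdExp_pos.mono fun x hx => ?_)
  rw [Real.norm_of_nonneg (codeWeight_nonneg hl hP hx.le)]
  exact codeWeight_le hl hP hx

lemma integral_codeWeight_le {l P : ℝ} (hl : 0 < l) (hP : 0 ≤ P) :
    ∫ x, codeWeight l P x ∂stdExp ≤ P := by
  rcases hP.eq_or_lt with rfl | hP'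
  · have : ∀ x, codeWeight l 0 x = 0 := fun x => by
      rw [codeWeight, zero_div, Real.zero_rpow (by positivity), mul_zero]
    simp [this]
  have ha : -(1 + l) < -1 := by linarith
  have hint : ∫ x in Set.Ioi 0, (x + P) ^ (-(1 + l)) = P ^ (-l) / l := by
    have := (measurePreserving_add_right volume P).setIntegral_preimage_emb
      (measurableEmbedding_addRight P) (fun x : ℝ => x ^ (-(1 + l))) (Set.Ioi P)
    rw [Set.preimage_add_const_Ioi, sub_self, integral_Ioi_rpow_of_lt ha hP'] at this
    rw [this, show -(1 + l) + 1 = -l by ring, neg_div_neg_eq]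
  have hI : IntegrableOn (fun x : ℝ => l * P ^ (1 + l) * (x + P) ^ (-(1 + l))) (Set.Ioi 0) :=
    (integrableOn_add_rpow_Ioi_of_lt ha (by linarith)).const_mul _
  have hval : ∫ x in Set.Ioi 0, l * P ^ (1 + l) * (x + P) ^ (-(1 + l)) = P := by
    rw [integral_const_mul, hint]
    have : P ^ (1 + l) * P ^ (-l) = P := by
      rw [← Real.rpow_add hP']; simp
    field_simp
    linarith
  rw [integral_eq_lintegral_of_nonneg_ae
    (ae_stdExp_pos.mono fun x hx => codeWeight_nonneg hl hP hx.le)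
    (measurable_codeWeight l P).aestronglyMeasurable]
  refine ENNReal.toReal_le_of_le_ofReal hP ?_
  refine le_of_le_of_eq (b := ENNReal.ofReal
    (∫ x in Set.Ioi 0, l * P ^ (1 + l) * (x + P) ^ (-(1 + l)))) ?_ (by rw [hval])
  rw [lintegral_stdExp (measurable_codeWeight l P).ennreal_ofReal,
    ofReal_integral_eq_lintegral_ofReal hI]
  · refine setLIntegral_mono' measurableSet_Ioi fun x hx => ?_
    have hx' : 0 < x := hx
    rw [← ENNReal.ofReal_mul (Real.exp_pos _).le]
    refine ENNReal.ofReal_le_ofReal ?_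
    have h1 : Real.exp (-x) ≤ 1 := Real.exp_le_one_iff.2 (by linarith)
    have h2 : codeWeight l P x = l * P ^ (1 + l) * (x + P) ^ (-(1 + l)) := by
      rw [codeWeight, Real.div_rpow hP (by positivity), Real.rpow_neg (by positivity),
        add_comm x P]
      ring
    rw [← h2]
    exact mul_le_of_le_one_left (codeWeight_nonneg hl hP hx'.le) h1
  · filter_upwards [ae_restrict_mem measurableSet_Ioi] with x hx
    have hx' : 0 < x := hx
    positivity

lemma setIntegral_raceWin_affine {p : ζ → ℝ} (hp : ∀ i, 0 ≤ p i) (hsum : ∑ i, p i = 1) (z : ζ)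
    (c d : ℝ) :
    ∫ e in raceWin p z, (c + d * e z) ∂(Measure.pi fun _ : ζ => stdExp)
      = c * p z + d * p z ^ 2 := by
  rw [integral_add (integrable_const c) ((integrableOn_raceWin hp hsum z).const_mul d),
    integral_const_mul, setIntegral_raceWin hp hsum, setIntegral_const,
    measureReal_raceWin' hp hsum, smul_eq_mul, mul_comm c]

end Race

lemma negMulLog_le_cross {a w : ℝ} (ha : 0 ≤ a) (hw : 0 ≤ w) (h : 0 < a → 0 < w) :
    Real.negMulLog a ≤ a * -Real.log w + w - a := by
  rcases ha.eq_or_lt with rfl | ha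
  · simpa using hw
  · have hw := h ha
    have h1 := Real.log_le_sub_one_of_pos (div_pos hw ha)
    rw [Real.log_div hw.ne' ha.ne'] at h1
    have h2 := mul_le_mul_of_nonneg_left h1 ha.le
    have h3 : a * (w / a - 1) = w - a := by field_simp
    rw [Real.negMulLog]
    linarith

section Coupling

variable {σ ζ : Type*} [Fintype σ] [Fintype ζ]

open Classical in
/-- The entropy of the image under `h` of the weights `a`. -/
noncomputable def imageEntropy (a : σ → ℝ) (h : σ → ζ) : ℝ :=
  ∑ z, Real.negMulLog (∑ s, if h s = z then a s else 0)

open Classical in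
lemma imageEntropy_winner_le [Nonempty ζ] {a : σ → ℝ} (ha : ∀ s, 0 ≤ a s) (ha1 : ∑ s, a s = 1)
    {p : σ → ζ → ℝ} (hp : ∀ s z, 0 ≤ p s z) (hp1 : ∀ s, ∑ z, p s z = 1)
    {P : ζ → ℝ} (hP : ∀ z, 0 ≤ P z) (hpos : ∀ s z, 0 < p s z → 0 < P z) {l : ℝ} (hl : 0 < l)
    {e : ζ → ℝ} (he : ∀ z, 0 < e z) (hwin : ∀ s z, winner (p s) e = z ↔ e ∈ raceWin (p s) z) :
    imageEntropy a (fun s => winner (p s) e)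
      ≤ ∑ s, a s * ∑ z, (raceWin (p s) z).indicator (fun e : ζ → ℝ =>
          (-Real.log l + (1 + l) * (Real.log (1 + p s z / P z)
              - p s z / P z / (1 + p s z / P z)))
            + (1 + l) / (P z * (1 + p s z / P z)) * e z) e
        + (∑ z, codeWeight l (P z) (e z) - 1) := by
  have hterm : ∀ z, Real.negMulLog (∑ s, if winner (p s) e = z then a s else 0)
      ≤ (∑ s, a s * (raceWin (p s) z).indicator (fun e : ζ → ℝ =>
          (-Real.log l + (1 + l) * (Real.log (1 + p s z / P z)
              - p s z / P z / (1 + p s z / P z)))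
            + (1 + l) / (P z * (1 + p s z / P z)) * e z) e)
        + codeWeight l (P z) (e z) - ∑ s, if winner (p s) e = z then a s else 0 := by
    intro z
    have hpz : ∀ s, winner (p s) e = z → 0 < P z := fun s hs =>
      hpos s z (pos_of_mem_raceWin (hp s) (hp1 s) he ((hwin s z).1 hs))
    refine (negMulLog_le_cross (w := codeWeight l (P z) (e z)) ?_
      (codeWeight_nonneg hl (hP z) (he z).le) ?_).trans ?_
    · exact Finset.sum_nonneg fun s _ => by split_ifs <;> simp [ha s]
    · intro h
      obtain ⟨s, -, hs⟩ := Finset.exists_ne_zero_of_sum_ne_zero h.ne'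
      have hs' : winner (p s) e = z := by
        by_contra hne
        exact hs (if_neg hne)
      have := hpz s hs'
      have := he z
      unfold codeWeight
      positivity
    · gcongr
      rw [Finset.sum_mul]
      refine Finset.sum_le_sum fun s _ => ?_
      by_cases hs : winner (p s) e = z
      · rw [if_pos hs, Set.indicator_of_mem ((hwin s z).1 hs)]
        refine mul_le_mul_of_nonneg_left ?_ (ha s)
        have hPz := hpz s hs
        have hr : 0 ≤ p s z / P z := div_nonneg (hp s z) hPz.le
        refine (neg_log_codeWeight_le hl hPz (he z) hr).trans_eq ?_
        have : 0 < 1 + p s z / P z := by positivity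
        generalize p s z / P z = r at *
        field_simp
        ring
      · rw [if_neg hs, Set.indicator_of_notMem (fun h => hs ((hwin s z).2 h))]
        simp
  have hmass : ∑ z, ∑ s, (if winner (p s) e = z then a s else 0) = 1 := by
    rw [Finset.sum_comm]
    simpa using ha1
  refine (Finset.sum_le_sum fun z _ => hterm z).trans_eq ?_
  simp only [Finset.sum_sub_distrib, Finset.sum_add_distrib, hmass, Finset.mul_sum]
  rw [Finset.sum_comm]
  ring

open Classical in
/-- Poisson functional representation: a coupling of the laws `p s` under which the entropy of
the value at a random `s` is small on average. -/
lemma exists_coupling {a : σ → ℝ} (ha : ∀ s, 0 ≤ a s) (ha1 : ∑ s, a s = 1)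
    {p : σ → ζ → ℝ} (hp : ∀ s z, 0 ≤ p s z) (hp1 : ∀ s, ∑ z, p s z = 1)
    {P : ζ → ℝ} (hP : ∀ z, 0 ≤ P z) (hP1 : ∑ z, P z = 1) (hpos : ∀ s z, 0 < p s z → 0 < P z)
    {l : ℝ} (hl : 0 < l) :
    ∃ q : (σ → ζ) → ℝ, (∀ h, 0 ≤ q h) ∧
      (∀ s z, ∑ h, (if h s = z then q h else 0) = p s z) ∧
      ∑ h, q h * imageEntropy a h
        ≤ -Real.log l + (1 + l) * ∑ s, a s * ∑ z, p s z * Real.log (1 + p s z / P z) := by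
  have : Nonempty ζ := by
    by_contra hne
    rw [not_nonempty_iff] at hne
    simp at hP1
  let : MeasurableSpace ζ := ⊤
  set ν := Measure.pi fun _ : ζ => stdExp
  set F : (ζ → ℝ) → σ → ζ := fun e s => winner (p s) e
  have hF : Measurable F := measurable_pi_iff.2 fun s => measurable_winner (p s)
  have hexp : ∀ Φ : (σ → ζ) → ℝ, ∑ h, ν.real (F ⁻¹' {h}) * Φ h = ∫ e, Φ (F e) ∂ν := by
    intro Φ
    have hm : Measurable Φ := measurable_of_finite Φ
    have := Measure.isProbabilityMeasure_map (μ := ν) hF.aemeasurable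
    rw [← integral_map hF.aemeasurable hm.aestronglyMeasurable,
      integral_fintype Integrable.of_finite]
    refine Finset.sum_congr rfl fun h _ => ?_
    rw [map_measureReal_apply hF (measurableSet_singleton h), smul_eq_mul]
  have hwin : ∀ᵐ e ∂ν, ∀ s z, winner (p s) e = z ↔ e ∈ raceWin (p s) z :=
    ae_all_iff.2 fun s => ae_winner_eq_iff (hp s) (hp1 s)
  refine ⟨fun h => ν.real (F ⁻¹' {h}), fun h => measureReal_nonneg, fun s z => ?_, ?_⟩
  · have := hexp fun h => if h s = z then 1 else 0
    simp only [mul_ite, mul_one, mul_zero] at this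
    rw [this, ← measureReal_raceWin' (hp s) (hp1 s) z,
      ← integral_indicator_one (measurableSet_raceWin (p s) z)]
    refine integral_congr_ae (hwin.mono fun e he => ?_)
    simp only [F, Set.indicator, he s z, Pi.one_apply]
  · rw [hexp]
    have hI1 : ∀ s z, Integrable ((raceWin (p s) z).indicator (fun e : ζ → ℝ =>
          (-Real.log l + (1 + l) * (Real.log (1 + p s z / P z)
              - p s z / P z / (1 + p s z / P z)))
            + (1 + l) / (P z * (1 + p s z / P z)) * e z)) ν := fun s z =>
      (integrable_indicator_iff (measurableSet_raceWin (p s) z)).2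
        ((integrable_const _).add ((integrableOn_raceWin (hp s) (hp1 s) z).const_mul _))
    have hI2 : ∀ z, Integrable (fun e : ζ → ℝ => codeWeight l (P z) (e z)) ν := fun z =>
      (measurePreserving_eval (fun _ : ζ => stdExp) z).integrable_comp_of_integrable
        (integrable_codeWeight hl (hP z))
    have hI1' : Integrable (fun e => ∑ s, a s * ∑ z, (raceWin (p s) z).indicator
        (fun e : ζ → ℝ => (-Real.log l + (1 + l) * (Real.log (1 + p s z / P z)
              - p s z / P z / (1 + p s z / P z)))
            + (1 + l) / (P z * (1 + p s z / P z)) * e z) e) ν :=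
      integrable_finsetSum _ fun s _ => (integrable_finsetSum _ fun z _ => hI1 s z).const_mul _
    have hI2' : Integrable (fun e : ζ → ℝ => ∑ z, codeWeight l (P z) (e z) - 1) ν :=
      (integrable_finsetSum _ fun z _ => hI2 z).sub (integrable_const 1)
    refine (integral_mono_ae ?_ (hI1'.add hI2') ?_).trans ?_
    · have := Measure.isProbabilityMeasure_map (μ := ν) hF.aemeasurable
      exact Integrable.comp_measurable (g := imageEntropy a) Integrable.of_finite hF
    · filter_upwards [hwin, ae_pi_stdExp_forall_pos] with e h1 h2
      exact imageEntropy_winner_le ha ha1 hp hp1 hP hpos hl h2 h1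
    · rw [integral_add' hI1' hI2', integral_sub (integrable_finsetSum _ fun z _ => hI2 z)
        (integrable_const 1), integral_finsetSum _ fun z _ => hI2 z,
        integral_finsetSum _ fun s _ =>
          (integrable_finsetSum _ fun z _ => hI1 s z).const_mul _]
      have hw : ∑ z, ∫ e : ζ → ℝ, codeWeight l (P z) (e z) ∂ν ≤ 1 := by
        rw [← hP1]
        refine Finset.sum_le_sum fun z _ => ?_
        have := integral_codeWeight_le hl (hP z)
        rwa [← (measurePreserving_eval (fun _ : ζ => stdExp) z).map_eq,
          integral_map (measurable_pi_apply z).aemeasurable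
            (measurable_codeWeight l (P z)).aestronglyMeasurable] at this
      have hs : ∀ s, ∫ e, a s * ∑ z, (raceWin (p s) z).indicator
          (fun e : ζ → ℝ => (-Real.log l + (1 + l) * (Real.log (1 + p s z / P z)
              - p s z / P z / (1 + p s z / P z)))
            + (1 + l) / (P z * (1 + p s z / P z)) * e z) e ∂ν
          = a s * (-Real.log l) + (1 + l) * (a s * ∑ z, p s z * Real.log (1 + p s z / P z)) := by
        intro s
        have hz : ∀ z, ∫ e, (raceWin (p s) z).indicator
          (fun e : ζ → ℝ => (-Real.log l + (1 + l) * (Real.log (1 + p s z / P z)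
              - p s z / P z / (1 + p s z / P z)))
            + (1 + l) / (P z * (1 + p s z / P z)) * e z) e ∂ν
            = p s z * (-Real.log l) + (1 + l) * (p s z * Real.log (1 + p s z / P z)) := by
          intro z
          rw [integral_indicator (measurableSet_raceWin (p s) z),
            setIntegral_raceWin_affine (hp s) (hp1 s)]
          rcases (hp s z).eq_or_lt with h0 | h0
          · simp [← h0]
          · have hPz := hpos s z h0
            have : 0 < 1 + p s z / P z := by positivity
            have hr : p s z = p s z / P z * P z := by field_simp
            generalize p s z / P z = r at *
            rw [hr]
            field_simp
            ring
        rw [integral_const_mul, integral_finsetSum _ fun z _ => hI1 s z,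
          Finset.sum_congr rfl fun z _ => hz z, Finset.sum_add_distrib, ← Finset.sum_mul, hp1,
          ← Finset.mul_sum]
        ring
      rw [Finset.sum_congr rfl fun s _ => hs s, Finset.sum_add_distrib, ← Finset.sum_mul, ha1,
        ← Finset.mul_sum]
      simp only [integral_const, probReal_univ, smul_eq_mul, mul_one]
      linarith

end Coupling


section Joint

variable {σ ζ τ : Type*} [Fintype σ] [Fintype ζ] [Fintype τ]

open Classical in
/-- Strong functional representation lemma in coupling form, for the joint weights `b`. -/
lemma exists_functional_representation {b : σ → ζ → ℝ} (hb : ∀ s z, 0 ≤ b s z)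
    (hb1 : ∑ s, ∑ z, b s z = 1) {I : ℝ}
    (hI : I = ∑ s, Real.negMulLog (∑ z, b s z) + ∑ z, Real.negMulLog (∑ s, b s z)
      - ∑ s, ∑ z, Real.negMulLog (b s z)) :
    ∃ (p : σ → ζ → ℝ) (q : (σ → ζ) → ℝ), (∀ s z, 0 ≤ p s z) ∧
      (∀ s z, (∑ y, b s y) * p s z = b s z) ∧ (∀ h, 0 ≤ q h) ∧ ∑ h, q h = 1 ∧
      (∀ s z, ∑ h, (if h s = z then q h else 0) = p s z) ∧
      ∑ h, q h * imageEntropy (fun s => ∑ z, b s z) h ≤ I + (Real.log (I + 1) + 4) := by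
  set a : σ → ℝ := fun s => ∑ z, b s z with ha_def
  set P : ζ → ℝ := fun z => ∑ s, b s z with hP_def
  have ha : ∀ s, 0 ≤ a s := fun s => Finset.sum_nonneg fun z _ => hb s z
  have hP : ∀ z, 0 ≤ P z := fun z => Finset.sum_nonneg fun s _ => hb s z
  have hP1 : ∑ z, P z = 1 := by rw [← hb1, Finset.sum_comm]
  have hba : ∀ s z, b s z ≤ a s := fun s z =>
    Finset.single_le_sum (f := fun z => b s z) (fun z _ => hb s z) (Finset.mem_univ z)
  have hbP : ∀ s z, b s z ≤ P z := fun s z =>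
    Finset.single_le_sum (f := fun s => b s z) (fun s _ => hb s z) (Finset.mem_univ s)
  set p : σ → ζ → ℝ := fun s z => if a s = 0 then P z else b s z / a s with hp_def
  have hp : ∀ s z, 0 ≤ p s z := fun s z => by
    simp only [hp_def]
    split_ifs
    exacts [hP z, div_nonneg (hb s z) (ha s)]
  have hp1 : ∀ s, ∑ z, p s z = 1 := fun s => by
    simp only [hp_def]
    split_ifs with h
    exacts [hP1, by rw [← Finset.sum_div]; exact div_self h]
  have hap : ∀ s z, a s * p s z = b s z := fun s z => by
    simp only [hp_def]
    split_ifs with h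
    · rw [h, zero_mul]
      exact le_antisymm (hb s z) (h ▸ hba s z)
    · field_simp
  have hpos : ∀ s z, 0 < p s z → 0 < P z := fun s z h => by
    simp only [hp_def] at h
    split_ifs at h with h0
    · exact h
    · have : b s z ≠ 0 := fun hz => by simp [hz] at h
      exact ((hb s z).lt_of_ne' this).trans_le (hbP s z)
  have hIeq : I = ∑ s, ∑ z, b s z * Real.log (p s z / P z) := by
    have hterm : ∀ s z, b s z * Real.log (p s z / P z)
        = -(b s z * Real.log (a s)) - b s z * Real.log (P z) - Real.negMulLog (b s z) := by
      intro s z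
      rcases (hb s z).eq_or_lt with h | h
      · simp [← h]
      · have h1 := h.trans_le (hba s z)
        have h2 := h.trans_le (hbP s z)
        have h3 : p s z = b s z / a s := if_neg h1.ne'
        rw [h3, Real.log_div (by positivity) h2.ne', Real.log_div h.ne' h1.ne', Real.negMulLog]
        ring
    simp only [hterm, Finset.sum_sub_distrib, Finset.sum_neg_distrib, ← Finset.sum_mul]
    rw [Finset.sum_comm (f := fun s z => b s z * Real.log (P z))]
    simp only [← Finset.sum_mul]
    rw [hI]
    simp only [Real.negMulLog, neg_mul, Finset.sum_neg_distrib, ha_def, hP_def]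
    ring
  have hprod : ∑ s, ∑ z, a s * P z = 1 := by
    simp only [← Finset.mul_sum, hP1, mul_one]
    exact hb1
  have hI0 : 0 ≤ I := by
    have hterm : ∀ s z, b s z - a s * P z ≤ b s z * Real.log (p s z / P z) := by
      intro s z
      rcases (hb s z).eq_or_lt with h | h
      · simpa [← h] using mul_nonneg (ha s) (hP z)
      · have h1 := h.trans_le (hba s z)
        have h2 := h.trans_le (hbP s z)
        have h3 : p s z = b s z / a s := if_neg h1.ne'
        have h4 := Real.one_sub_inv_le_log_of_pos (x := p s z / P z) (by rw [h3]; positivity)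
        have h5 := mul_le_mul_of_nonneg_left h4 h.le
        have h6 : b s z * (1 - (p s z / P z)⁻¹) = b s z - a s * P z := by
          rw [h3]; field_simp
        linarith
    have := Finset.sum_le_sum fun s (_ : s ∈ Finset.univ) =>
      Finset.sum_le_sum fun z (_ : z ∈ Finset.univ) => hterm s z
    simp only [Finset.sum_sub_distrib] at this
    rw [hb1, hprod, ← hIeq] at this
    linarith
  have hbound : ∑ s, a s * ∑ z, p s z * Real.log (1 + p s z / P z) ≤ I + 1 := by
    have hterm : ∀ s z, a s * (p s z * Real.log (1 + p s z / P z))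
        ≤ b s z * Real.log (p s z / P z) + a s * P z := by
      intro s z
      rw [← mul_assoc, hap]
      rcases (hb s z).eq_or_lt with h | h
      · simpa [← h] using mul_nonneg (ha s) (hP z)
      · have h1 := h.trans_le (hba s z)
        have h2 := h.trans_le (hbP s z)
        have h3 : p s z = b s z / a s := if_neg h1.ne'
        have hr : 0 < p s z / P z := by rw [h3]; positivity
        have h4 : Real.log (1 + p s z / P z)
            ≤ Real.log (p s z / P z) + (p s z / P z)⁻¹ := by
          have h5 := Real.log_le_sub_one_of_pos (x := (1 + p s z / P z) / (p s z / P z))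
            (by positivity)
          rw [Real.log_div (by positivity) hr.ne', add_div, div_self hr.ne', one_div] at h5
          linarith
        have h5 := mul_le_mul_of_nonneg_left h4 h.le
        have h6 : b s z * (p s z / P z)⁻¹ = a s * P z := by
          rw [h3]; field_simp
        linarith
    have := Finset.sum_le_sum fun s (_ : s ∈ Finset.univ) =>
      Finset.sum_le_sum fun z (_ : z ∈ Finset.univ) => hterm s z
    simp only [Finset.sum_add_distrib] at this
    rw [hprod, ← hIeq] at this
    simpa only [Finset.mul_sum] using this
  have hM : 0 < I + 1 := by linarith
  obtain ⟨q, hq, hqm, hqH⟩ := exists_coupling ha hb1 hp hp1 hP hP1 hpos (inv_pos.2 hM)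
  refine ⟨p, q, hp, hap, hq, ?_, hqm, hqH.trans ?_⟩
  · obtain ⟨s, -, -⟩ := Finset.exists_ne_zero_of_sum_ne_zero (hb1.trans_ne one_ne_zero)
    rw [← hp1 s, ← Finset.sum_congr rfl fun z _ => hqm s z, Finset.sum_comm]
    simp
  · have h1 := mul_le_mul_of_nonneg_left hbound (by positivity : 0 ≤ 1 + (I + 1)⁻¹)
    have h2 : (1 + (I + 1)⁻¹) * (I + 1) = I + 2 := by field_simp; ring
    rw [Real.log_inv]
    linarith

lemma negMulLog_sum_le {t : ζ → ℝ} (ht : ∀ z, 0 ≤ t z) :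
    Real.negMulLog (∑ z, t z) ≤ ∑ z, Real.negMulLog (t z) := by
  rw [Real.negMulLog, neg_mul, Finset.sum_mul, ← Finset.sum_neg_distrib]
  refine Finset.sum_le_sum fun z _ => ?_
  rcases (ht z).eq_or_lt with h | h
  · simp [← h]
  · rw [Real.negMulLog, neg_mul, neg_le_neg_iff]
    exact mul_le_mul_of_nonneg_left
      (Real.log_le_log h (Finset.single_le_sum (fun z _ => ht z) (Finset.mem_univ z))) h.le

/-- Strong subadditivity of entropy for the weights `t`. -/
lemma entropy_submodular {t : σ → τ → ζ → ℝ} (ht : ∀ x y z, 0 ≤ t x y z) :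
    ∑ x, ∑ y, ∑ z, Real.negMulLog (t x y z) + ∑ z, Real.negMulLog (∑ x, ∑ y, t x y z)
      ≤ ∑ x, ∑ z, Real.negMulLog (∑ y, t x y z) + ∑ z, ∑ y, Real.negMulLog (∑ x, t x y z) := by
  set A : σ → ζ → ℝ := fun x z => ∑ y, t x y z with hA
  set B : τ → ζ → ℝ := fun y z => ∑ x, t x y z with hB
  set C : ζ → ℝ := fun z => ∑ x, ∑ y, t x y z with hC
  have hA0 : ∀ x z, 0 ≤ A x z := fun x z => Finset.sum_nonneg fun y _ => ht x y z
  have hB0 : ∀ y z, 0 ≤ B y z := fun y z => Finset.sum_nonneg fun x _ => ht x y z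
  have hC0 : ∀ z, 0 ≤ C z := fun z => Finset.sum_nonneg fun x _ => hA0 x z
  have htA : ∀ x y z, t x y z ≤ A x z := fun x y z =>
    Finset.single_le_sum (f := fun y => t x y z) (fun y _ => ht x y z) (Finset.mem_univ y)
  have htB : ∀ x y z, t x y z ≤ B y z := fun x y z =>
    Finset.single_le_sum (f := fun x => t x y z) (fun x _ => ht x y z) (Finset.mem_univ x)
  have hAC : ∀ x z, A x z ≤ C z := fun x z =>
    Finset.single_le_sum (f := fun x => A x z) (fun x _ => hA0 x z) (Finset.mem_univ x)
  have hBC : ∀ z, ∑ y, B y z = C z := fun z => by rw [hC, hB, Finset.sum_comm]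
  have hz : ∀ z, ∑ x, ∑ y, Real.negMulLog (t x y z) + Real.negMulLog (C z)
      ≤ ∑ x, Real.negMulLog (A x z) + ∑ y, Real.negMulLog (B y z) := by
    intro z
    have hterm : ∀ x y, Real.negMulLog (t x y z)
        ≤ -(t x y z * Real.log (A x z)) - t x y z * Real.log (B y z)
          + t x y z * Real.log (C z) + (A x z * B y z / C z - t x y z) := by
      intro x y
      rcases (ht x y z).eq_or_lt with h | h
      · simpa [← h] using div_nonneg (mul_nonneg (hA0 x z) (hB0 y z)) (hC0 z)
      · have h1 := h.trans_le (htA x y z)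
        have h2 := h.trans_le (htB x y z)
        have h3 := h1.trans_le (hAC x z)
        have := negMulLog_le_cross h.le (w := A x z * B y z / C z) (by positivity)
          fun _ => by positivity
        rw [Real.log_div (by positivity) h3.ne', Real.log_mul h1.ne' h2.ne'] at this
        linarith
    have := Finset.sum_le_sum fun x (_ : x ∈ Finset.univ) =>
      Finset.sum_le_sum fun y (_ : y ∈ Finset.univ) => hterm x y
    simp only [Finset.sum_sub_distrib, Finset.sum_add_distrib, Finset.sum_neg_distrib,
      ← Finset.sum_mul, ← Finset.sum_div, ← Finset.mul_sum] at this
    rw [Finset.sum_comm (f := fun x y => t x y z * Real.log (B y z))] at this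
    simp only [← Finset.sum_mul, hBC] at this
    have hCC : (∑ x, A x z) * C z / C z = C z := by
      rw [show ∑ x, A x z = C z from rfl, mul_self_div_self]
    rw [hCC] at this
    simp only [Real.negMulLog, neg_mul, Finset.sum_neg_distrib] at this ⊢
    simp only [hA, hB, hC] at this ⊢
    linarith
  have := Finset.sum_le_sum fun z (_ : z ∈ Finset.univ) => hz z
  simp only [Finset.sum_add_distrib] at this
  have e1 : ∑ x, ∑ y, ∑ z, Real.negMulLog (t x y z) = ∑ z, ∑ x, ∑ y, Real.negMulLog (t x y z) := by
    rw [Finset.sum_comm (s := Finset.univ (α := ζ))]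
    exact Finset.sum_congr rfl fun x _ => Finset.sum_comm
  rw [e1, Finset.sum_comm (f := fun x z => Real.negMulLog (A x z))]
  exact this

end Joint

section Entropy

open Classical in
lemma measureReal_preimage_eq_sum {Ω : Type*} [Fintype Ω] [MeasurableSpace Ω]
    [MeasurableSingletonClass Ω] (P : Measure Ω) [IsFiniteMeasure P] {α : Type*} (X : Ω → α)
    (x : α) : (P (X ⁻¹' {x})).toReal = ∑ ω, if X ω = x then P.real {ω} else 0 := by
  rw [← Finset.sum_filter, sum_measureReal_singleton, Measure.real]
  congr 2
  ext ω
  simp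

open Classical in
lemma infH_eq_sum {Ω : Type*} [Fintype Ω] [MeasurableSpace Ω] [MeasurableSingletonClass Ω]
    (P : Measure Ω) [IsFiniteMeasure P] {α : Type*} [Fintype α] (X : Ω → α) :
    infH P X = ∑ x, Real.negMulLog (∑ ω, if X ω = x then P.real {ω} else 0) :=
  Finset.sum_congr rfl fun x _ => by rw [measureReal_preimage_eq_sum]

/-- The finitely supported measure with weights `m`. -/
noncomputable def weightMeasure {Ω : Type*} [Fintype Ω] [MeasurableSpace Ω] (m : Ω → ℝ) :
    Measure Ω :=
  ∑ ω, ENNReal.ofReal (m ω) • Measure.dirac ω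

lemma weightMeasure_singleton {Ω : Type*} [Fintype Ω] [MeasurableSpace Ω]
    [MeasurableSingletonClass Ω] (m : Ω → ℝ) (ω : Ω) :
    weightMeasure m {ω} = ENNReal.ofReal (m ω) := by
  classical
  simp [weightMeasure, Measure.finsetSum_apply, Set.indicator_apply]

instance isFiniteMeasure_weightMeasure {Ω : Type*} [Fintype Ω] [MeasurableSpace Ω] (m : Ω → ℝ) :
    IsFiniteMeasure (weightMeasure m) := by
  refine ⟨?_⟩
  simp [weightMeasure, Measure.finsetSum_apply, ENNReal.sum_lt_top]

lemma weightMeasure_real_singleton {Ω : Type*} [Fintype Ω] [MeasurableSpace Ω]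
    [MeasurableSingletonClass Ω] {m : Ω → ℝ} (hm : ∀ ω, 0 ≤ m ω) (ω : Ω) :
    (weightMeasure m).real {ω} = m ω := by
  rw [Measure.real, weightMeasure_singleton, ENNReal.toReal_ofReal (hm ω)]

lemma infH_comp_of_map_eq {Ω Ω' : Type*} [MeasurableSpace Ω] [MeasurableSpace Ω'] [Finite Ω']
    [MeasurableSingletonClass Ω'] {P : Measure Ω} {μ : Measure Ω'} {T : Ω → Ω'}
    (hT : Measurable T) (h : P.map T = μ) {α : Type*} [Fintype α] (g : Ω' → α) :
    infH P (fun ω => g (T ω)) = infH μ g := by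
  unfold infH
  refine Finset.sum_congr rfl fun x _ => ?_
  rw [← h, Measure.map_apply hT (Set.toFinite _).measurableSet]
  rfl

end Entropy

section Channel

variable {σ ζ τ : Type} [Fintype σ] [MeasurableSpace σ] [MeasurableSingletonClass σ]
  [Fintype ζ] [MeasurableSpace ζ] [MeasurableSingletonClass ζ]
  [Fintype τ] [MeasurableSpace τ] [MeasurableSingletonClass τ]

open Classical in
/-- A variable generated from the first two coordinates through the channel `κ`, with the
values of its mutual informations. -/
lemma exists_channel_output (μ : Measure (σ × ζ × τ)) [IsProbabilityMeasure μ] {n : ℕ}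
    {κ : Fin n → σ → ζ → ℝ} (hκ : ∀ v s z, 0 ≤ κ v s z) {b : σ → ζ → ℝ}
    (hb : ∀ s z, b s z = ∑ w, μ.real {(s, z, w)})
    (hκ1 : ∀ s z, b s z ≠ 0 → ∑ v, κ v s z = 1) :
    ∃ (Ω : Type) (_ : MeasurableSpace Ω) (P : Measure Ω) (_ : IsProbabilityMeasure P)
      (Sv : Ω → σ) (Zv : Ω → ζ) (Wv : Ω → τ) (U : Ω → Fin n),
      Measurable Sv ∧ Measurable Zv ∧ Measurable Wv ∧ Measurable U ∧
      P.map (fun ω => (Sv ω, Zv ω, Wv ω)) = μ ∧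
      infCMI P U Wv (fun ω => (Sv ω, Zv ω)) = 0 ∧
      infMI P U Sv = ∑ v, Real.negMulLog (∑ s, ∑ z, κ v s z * b s z)
        + infH μ (fun p => p.1) - ∑ v, ∑ s, Real.negMulLog (∑ z, κ v s z * b s z) ∧
      infMI P U Wv ≥ ∑ v, Real.negMulLog (∑ s, ∑ z, κ v s z * b s z)
        + infH μ (fun p => p.2.1) - ∑ v, ∑ z, Real.negMulLog (∑ s, κ v s z * b s z)
        - infCondH μ (fun p => p.2.1) (fun p => p.2.2) := by
  set ρ : σ → ζ → τ → ℝ := fun s z w => μ.real {(s, z, w)} with hρ_def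
  have hρ : ∀ s z w, 0 ≤ ρ s z w := fun s z w => measureReal_nonneg
  have hκρ : ∀ s z w, (∑ v, κ v s z) * ρ s z w = ρ s z w := by
    intro s z w
    by_cases h : b s z = 0
    · have h0 : ρ s z w = 0 := by
        rw [hb, Finset.sum_eq_zero_iff_of_nonneg fun w _ => hρ s z w] at h
        exact h w (Finset.mem_univ w)
      rw [h0, mul_zero]
    · rw [hκ1 s z h, one_mul]
  have hκb : ∀ v s z, ∑ w, κ v s z * ρ s z w = κ v s z * b s z := fun v s z => by
    rw [← Finset.mul_sum, hb]
  set m : Fin n × σ × ζ × τ → ℝ := fun ω => κ ω.1 ω.2.1 ω.2.2.1 * ρ ω.2.1 ω.2.2.1 ω.2.2.2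
    with hm_def
  have hm : ∀ ω, 0 ≤ m ω := fun ω => mul_nonneg (hκ _ _ _) (hρ _ _ _)
  set P := weightMeasure m with hP_def
  have hmap : P.map (fun ω => (ω.2.1, ω.2.2.1, ω.2.2.2)) = μ := by
    refine Measure.ext_of_singleton fun x => ?_
    rw [Measure.map_apply (by fun_prop) (measurableSet_singleton x),
      ← ENNReal.toReal_eq_toReal_iff' (measure_ne_top _ _) (measure_ne_top _ _),
      measureReal_preimage_eq_sum]
    obtain ⟨s, z, w⟩ := x
    simp only [hP_def, weightMeasure_real_singleton hm]
    simp only [Fintype.sum_prod_type, Prod.mk.injEq, ite_and, Finset.sum_ite_irrel,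
      Finset.sum_const_zero, Finset.sum_ite_eq', Finset.mem_univ, if_true, hm_def]
    rw [← Finset.sum_mul, hκρ]
    rfl
  have hprob : IsProbabilityMeasure P := by
    rw [← Measure.isProbabilityMeasure_map_iff (f := fun ω => (ω.2.1, ω.2.2.1, ω.2.2.2))
      (by fun_prop), hmap]
    infer_instance
  have hH : ∀ {α : Type} [Fintype α] (X : Fin n × σ × ζ × τ → α),
      infH P X = ∑ x, Real.negMulLog (∑ ω, if X ω = x then m ω else 0) := by
    intro α _ X
    rw [infH_eq_sum]
    simp only [hP_def, weightMeasure_real_singleton hm]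
  have hμ : ∀ {α : Type} [Fintype α] (g : σ × ζ × τ → α),
      infH P (fun ω => g (ω.2.1, ω.2.2.1, ω.2.2.2)) = infH μ g := fun g =>
    infH_comp_of_map_eq (by fun_prop) hmap g
  have hU : infH P (fun ω => ω.1) = ∑ v, Real.negMulLog (∑ s, ∑ z, κ v s z * b s z) := by
    rw [hH]
    simp only [Fintype.sum_prod_type, Finset.sum_ite_irrel,
      Finset.sum_const_zero, Finset.sum_ite_eq', Finset.mem_univ, if_true, hm_def, hκb]
  have hUS : infH P (fun ω => (ω.1, ω.2.1))
      = ∑ v, ∑ s, Real.negMulLog (∑ z, κ v s z * b s z) := by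
    rw [hH]
    simp only [Fintype.sum_prod_type, Prod.mk.injEq, ite_and, Finset.sum_ite_irrel,
      Finset.sum_const_zero, Finset.sum_ite_eq', Finset.mem_univ, if_true, hm_def, hκb]
  have hUZ : infH P (fun ω => (ω.1, ω.2.2.1))
      = ∑ v, ∑ z, Real.negMulLog (∑ s, κ v s z * b s z) := by
    rw [hH]
    simp only [Fintype.sum_prod_type, Prod.mk.injEq, ite_and, Finset.sum_ite_irrel,
      Finset.sum_const_zero, Finset.sum_ite_eq', Finset.mem_univ, if_true, hm_def, hκb]
  refine ⟨Fin n × σ × ζ × τ, inferInstance, P, hprob, fun ω => ω.2.1, fun ω => ω.2.2.1,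
    fun ω => ω.2.2.2, fun ω => ω.1, by fun_prop, by fun_prop, by fun_prop, by fun_prop, hmap,
    ?_, ?_, ?_⟩
  · have hUSZ : infH P (fun ω => (ω.1, ω.2.1, ω.2.2.1))
        = ∑ v, ∑ s, ∑ z, Real.negMulLog (κ v s z * b s z) := by
      rw [hH]
      simp only [Fintype.sum_prod_type, Prod.mk.injEq, ite_and, Finset.sum_ite_irrel,
        Finset.sum_const_zero, Finset.sum_ite_eq', Finset.mem_univ, if_true, hm_def, hκb]
    have hWSZ : infH P (fun ω => (ω.2.2.2, ω.2.1, ω.2.2.1))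
        = ∑ w, ∑ s, ∑ z, Real.negMulLog (ρ s z w) := by
      rw [hH]
      simp only [Fintype.sum_prod_type, Prod.mk.injEq, ite_and, Finset.sum_ite_irrel,
        Finset.sum_const_zero, Finset.sum_ite_eq', Finset.mem_univ, if_true, hm_def,
        ← Finset.sum_mul, hκρ]
    have hSZ : infH P (fun ω => (ω.2.1, ω.2.2.1)) = ∑ s, ∑ z, Real.negMulLog (b s z) := by
      rw [hH]
      simp only [Fintype.sum_prod_type, Prod.mk.injEq, ite_and, Finset.sum_ite_irrel,
        Finset.sum_const_zero, Finset.sum_ite_eq', Finset.mem_univ, if_true, hm_def]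
      refine Finset.sum_congr rfl fun s _ => Finset.sum_congr rfl fun z _ => ?_
      rw [Finset.sum_comm]
      simp only [← Finset.sum_mul, hκρ, hb]
      rfl
    have hUWSZ : infH P (fun ω => ((ω.1, ω.2.2.2), ω.2.1, ω.2.2.1))
        = ∑ v, ∑ w, ∑ s, ∑ z, Real.negMulLog (κ v s z * ρ s z w) := by
      rw [hH]
      simp only [Fintype.sum_prod_type, Prod.mk.injEq, ite_and, Finset.sum_ite_irrel,
        Finset.sum_const_zero, Finset.sum_ite_eq', Finset.mem_univ, if_true, hm_def]
    have hsplit : ∀ s z, ∑ v, Real.negMulLog (κ v s z * b s z) + ∑ w, Real.negMulLog (ρ s z w)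
        = Real.negMulLog (b s z) + ∑ v, ∑ w, Real.negMulLog (κ v s z * ρ s z w) := by
      intro s z
      by_cases h : b s z = 0
      · have h0 : ∀ w, ρ s z w = 0 := fun w => by
          rw [hb, Finset.sum_eq_zero_iff_of_nonneg fun w _ => hρ s z w] at h
          exact h w (Finset.mem_univ w)
        simp [h, h0]
      · simp only [Real.negMulLog_mul, Finset.sum_add_distrib, ← Finset.sum_mul, ← Finset.mul_sum,
          hκ1 s z h, one_mul]
        rw [show ∑ w, ρ s z w = b s z from (hb s z).symm]
        ring
    have hsum := Finset.sum_congr rfl fun s (_ : s ∈ Finset.univ) =>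
      Finset.sum_congr rfl fun z (_ : z ∈ Finset.univ) => hsplit s z
    simp only [Finset.sum_add_distrib] at hsum
    have e1 : ∑ s, ∑ z, ∑ v, Real.negMulLog (κ v s z * b s z)
        = ∑ v, ∑ s, ∑ z, Real.negMulLog (κ v s z * b s z) := by
      rw [Finset.sum_comm (s := Finset.univ (α := Fin n))]
      exact Finset.sum_congr rfl fun s _ => Finset.sum_comm
    have e2 : ∑ s, ∑ z, ∑ w, Real.negMulLog (ρ s z w)
        = ∑ w, ∑ s, ∑ z, Real.negMulLog (ρ s z w) := by
      rw [Finset.sum_comm (s := Finset.univ (α := τ))]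
      exact Finset.sum_congr rfl fun s _ => Finset.sum_comm
    have e3 : ∑ s, ∑ z, ∑ v, ∑ w, Real.negMulLog (κ v s z * ρ s z w)
        = ∑ v, ∑ w, ∑ s, ∑ z, Real.negMulLog (κ v s z * ρ s z w) := by
      have h1 : ∀ s, ∑ z, ∑ v, ∑ w, Real.negMulLog (κ v s z * ρ s z w)
          = ∑ v, ∑ w, ∑ z, Real.negMulLog (κ v s z * ρ s z w) := fun s => by
        rw [Finset.sum_comm]
        exact Finset.sum_congr rfl fun v _ => Finset.sum_comm
      rw [Finset.sum_congr rfl fun s _ => h1 s, Finset.sum_comm]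
      exact Finset.sum_congr rfl fun v _ => Finset.sum_comm
    unfold infCMI infCondH
    rw [hUSZ, hWSZ, hSZ, hUWSZ]
    linarith
  · unfold infMI
    rw [hU, hUS, hμ fun p => p.1]
  · have hUW : infH P (fun ω => (ω.1, ω.2.2.2))
        ≤ ∑ v, ∑ w, ∑ z, Real.negMulLog (∑ s, κ v s z * ρ s z w) := by
      rw [hH]
      simp only [Fintype.sum_prod_type, Prod.mk.injEq, ite_and, Finset.sum_ite_irrel,
        Finset.sum_const_zero, Finset.sum_ite_eq', Finset.mem_univ, if_true, hm_def]
      refine Finset.sum_le_sum fun v _ => Finset.sum_le_sum fun w _ => ?_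
      rw [Finset.sum_comm]
      exact negMulLog_sum_le fun z => Finset.sum_nonneg fun s _ => mul_nonneg (hκ v s z) (hρ s z w)
    have hZW : infH P (fun ω => (ω.2.2.1, ω.2.2.2))
        = ∑ z, ∑ w, Real.negMulLog (∑ v, ∑ s, κ v s z * ρ s z w) := by
      rw [hH]
      simp only [Fintype.sum_prod_type, Finset.sum_ite_eq', Finset.mem_univ, if_true, hm_def]
    have hZ : infH P (fun ω => ω.2.2.1)
        = ∑ z, Real.negMulLog (∑ v, ∑ w, ∑ s, κ v s z * ρ s z w) := by
      rw [hH]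
      simp only [Fintype.sum_prod_type, Finset.sum_ite_irrel,
        Finset.sum_const_zero, Finset.sum_ite_eq', Finset.mem_univ, if_true, hm_def]
      refine Finset.sum_congr rfl fun z _ => congrArg _ (Finset.sum_congr rfl fun v _ => ?_)
      exact Finset.sum_comm
    have hUZ' : infH P (fun ω => (ω.1, ω.2.2.1))
        = ∑ v, ∑ z, Real.negMulLog (∑ w, ∑ s, κ v s z * ρ s z w) := by
      rw [hUZ]
      refine Finset.sum_congr rfl fun v _ => Finset.sum_congr rfl fun z _ => congrArg _ ?_
      rw [Finset.sum_comm]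
      simp only [hκb]
    have hsub := entropy_submodular (t := fun v w z => ∑ s, κ v s z * ρ s z w)
      fun v w z => Finset.sum_nonneg fun s _ => mul_nonneg (hκ v s z) (hρ s z w)
    unfold infMI infCondH
    rw [hU, ← hUZ, ← hμ fun p => p.2.1, ← hμ fun p => (p.2.1, p.2.2), ← hμ fun p => p.2.2]
    simp only at hsub ⊢
    linarith

end Channel

section Channel

variable {σ ζ τ : Type} [Fintype σ] [MeasurableSpace σ] [MeasurableSingletonClass σ]
  [Fintype ζ] [MeasurableSpace ζ] [MeasurableSingletonClass ζ]
  [Fintype τ] [MeasurableSpace τ] [MeasurableSingletonClass τ]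

open Classical in
lemma infH_marginals (μ : Measure (σ × ζ × τ)) [IsProbabilityMeasure μ] {b : σ → ζ → ℝ}
    (hb : ∀ s z, b s z = ∑ w, μ.real {(s, z, w)}) :
    ∑ s, ∑ z, b s z = 1 ∧
    infH μ (fun p => p.1) = ∑ s, Real.negMulLog (∑ z, b s z) ∧
    infH μ (fun p => p.2.1) = ∑ z, Real.negMulLog (∑ s, b s z) ∧
    infH μ (fun p => (p.1, p.2.1)) = ∑ s, ∑ z, Real.negMulLog (b s z) ∧
    infH μ (fun p => (p.2.1, p.1)) = ∑ s, ∑ z, Real.negMulLog (b s z) := by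
  refine ⟨?_, ?_, ?_, ?_, ?_⟩
  · simp only [hb]
    have h := sum_measureReal_singleton (μ := μ) Finset.univ
    simp only [Finset.coe_univ, probReal_univ, Fintype.sum_prod_type] at h
    simpa [Fintype.sum_prod_type] using h
  · simp only [infH_eq_sum, Fintype.sum_prod_type, hb]
    refine Finset.sum_congr rfl fun s _ => congrArg _ ?_
    rw [Finset.sum_eq_single s (fun s' _ h => by simp [h]) (by simp)]
    simp
  · simp only [infH_eq_sum, Fintype.sum_prod_type, hb]
    refine Finset.sum_congr rfl fun z _ => congrArg _ (Finset.sum_congr rfl fun s _ => ?_)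
    rw [Finset.sum_eq_single z (fun z' _ h => by simp [h]) (by simp)]
    simp
  · rw [infH_eq_sum]
    simp only [Fintype.sum_prod_type, Prod.mk.injEq, ite_and, Finset.sum_ite_irrel,
      Finset.sum_const_zero, Finset.sum_ite_eq', Finset.mem_univ, if_true, hb]
  · rw [Finset.sum_comm, infH_eq_sum]
    simp only [Fintype.sum_prod_type, Prod.mk.injEq, ite_and, Finset.sum_ite_irrel,
      Finset.sum_const_zero, Finset.sum_ite_eq', Finset.mem_univ, if_true, hb]

end Channel

section Erasure

variable {σ ζ : Type*}

open Classical in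
/-- The channel which reveals its input with probability `α` and otherwise outputs a random
function `h : σ → ζ` of law `q`, conditioned on mapping the first input to the second. -/
noncomputable def erasureChannel (α : ℝ) (p : σ → ζ → ℝ) (q : (σ → ζ) → ℝ) :
    (σ × ζ) ⊕ (σ → ζ) → σ → ζ → ℝ
  | .inl x, s, z => if x = (s, z) then α else 0
  | .inr h, s, z => (1 - α) * if h s = z then q h / p s z else 0

variable {α : ℝ} {p : σ → ζ → ℝ} {q : (σ → ζ) → ℝ} {b : σ → ζ → ℝ}

lemma erasureChannel_nonneg (hα : 0 ≤ α) (hα1 : α ≤ 1) (hp : ∀ s z, 0 ≤ p s z)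
    (hq : ∀ h, 0 ≤ q h) (v : (σ × ζ) ⊕ (σ → ζ)) (s : σ) (z : ζ) :
    0 ≤ erasureChannel α p q v s z := by
  cases v with
  | inl x =>
    simp only [erasureChannel]
    split_ifs
    exacts [hα, le_rfl]
  | inr h =>
    refine mul_nonneg (sub_nonneg.2 hα1) ?_
    split_ifs
    exacts [div_nonneg (hq h) (hp s z), le_rfl]

open Classical in
lemma erasureChannel_inl_mul (x : σ × ζ) (s : σ) (z : ζ) :
    erasureChannel α p q (.inl x) s z * b s z
      = if x.1 = s then (if x.2 = z then α * b s z else 0) else 0 := by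
  obtain ⟨s', z'⟩ := x
  simp only [erasureChannel, Prod.mk.injEq, ite_and]
  split_ifs <;> simp

variable [Fintype σ] [Fintype ζ]

open Classical in
lemma sum_erasureChannel (hqp : ∀ s z, ∑ h, (if h s = z then q h else 0) = p s z) {s : σ} {z : ζ}
    (hps : p s z ≠ 0) : ∑ v, erasureChannel α p q v s z = 1 := by
  have h : ∑ h : σ → ζ, (if h s = z then q h / p s z else 0) = 1 := by
    rw [← div_self hps]
    nth_rewrite 2 [← hqp s z]
    rw [Finset.sum_div]
    refine Finset.sum_congr rfl fun h _ => ?_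
    split_ifs <;> simp
  simp only [Fintype.sum_sum_type, erasureChannel, ← Finset.mul_sum, h]
  simp

open Classical in
lemma erasureChannel_inr_mul (hq : ∀ h, 0 ≤ q h)
    (hqp : ∀ s z, ∑ h, (if h s = z then q h else 0) = p s z)
    (hpb : ∀ s z, (∑ y, b s y) * p s z = b s z) (h : σ → ζ) (s : σ) (z : ζ) :
    erasureChannel α p q (.inr h) s z * b s z
      = if h s = z then (1 - α) * q h * ∑ y, b s y else 0 := by
  simp only [erasureChannel]
  split_ifs with hz
  · by_cases hps : p s z = 0
    · have h0 : q h = 0 := by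
        have h1 := hqp s z
        rw [hps, Finset.sum_eq_zero_iff_of_nonneg fun h _ => by
          split_ifs
          exacts [hq h, le_rfl]] at h1
        simpa [hz] using h1 h (Finset.mem_univ h)
      simp [h0]
    · rw [← hpb s z]
      field_simp
  · simp

open Classical in
lemma sum_negMulLog_erasureChannel (hb1 : ∑ s, ∑ z, b s z = 1) (hq : ∀ h, 0 ≤ q h)
    (hqp : ∀ s z, ∑ h, (if h s = z then q h else 0) = p s z)
    (hpb : ∀ s z, (∑ y, b s y) * p s z = b s z) :
    ∑ v, Real.negMulLog (∑ s, ∑ z, erasureChannel α p q v s z * b s z)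
      = ∑ s, ∑ z, Real.negMulLog (α * b s z) + ∑ h, Real.negMulLog ((1 - α) * q h) := by
  simp only [Fintype.sum_sum_type, erasureChannel_inl_mul, erasureChannel_inr_mul hq hqp hpb]
  congr 1
  · simp [Fintype.sum_prod_type, Finset.sum_ite_irrel]
  · simp [← Finset.mul_sum, hb1]

open Classical in
lemma sum_negMulLog_erasureChannel_left (hb1 : ∑ s, ∑ z, b s z = 1) (hq : ∀ h, 0 ≤ q h)
    (hq1 : ∑ h, q h = 1) (hqp : ∀ s z, ∑ h, (if h s = z then q h else 0) = p s z)
    (hpb : ∀ s z, (∑ y, b s y) * p s z = b s z) :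
    ∑ v, ∑ s, Real.negMulLog (∑ z, erasureChannel α p q v s z * b s z)
      = ∑ s, ∑ z, Real.negMulLog (α * b s z) + ∑ h, Real.negMulLog ((1 - α) * q h)
        + (1 - α) * ∑ s, Real.negMulLog (∑ z, b s z) := by
  simp only [Fintype.sum_sum_type, erasureChannel_inl_mul, erasureChannel_inr_mul hq hqp hpb]
  rw [add_assoc]
  congr 1
  · simp [Fintype.sum_prod_type, Finset.sum_ite_irrel, apply_ite Real.negMulLog]
  · simp only [Finset.sum_ite_eq, Finset.mem_univ, if_true]
    simp only [Real.negMulLog_mul (_ * _) (∑ y, b _ y), Finset.sum_add_distrib,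
      ← Finset.mul_sum, ← Finset.sum_mul, hb1, hq1]
    simp

open Classical in
lemma sum_negMulLog_erasureChannel_right (hb1 : ∑ s, ∑ z, b s z = 1) (hq : ∀ h, 0 ≤ q h)
    (hqp : ∀ s z, ∑ h, (if h s = z then q h else 0) = p s z)
    (hpb : ∀ s z, (∑ y, b s y) * p s z = b s z) :
    ∑ v, ∑ z, Real.negMulLog (∑ s, erasureChannel α p q v s z * b s z)
      = ∑ s, ∑ z, Real.negMulLog (α * b s z) + ∑ h, Real.negMulLog ((1 - α) * q h)
        + (1 - α) * ∑ h, q h * imageEntropy (fun s => ∑ z, b s z) h := by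
  simp only [Fintype.sum_sum_type, erasureChannel_inl_mul, erasureChannel_inr_mul hq hqp hpb]
  rw [add_assoc]
  congr 1
  · simp [Fintype.sum_prod_type, apply_ite Real.negMulLog]
  · rw [Finset.mul_sum, ← Finset.sum_add_distrib]
    refine Finset.sum_congr rfl fun h _ => ?_
    have h1 : ∀ z, ∑ s, (if h s = z then (1 - α) * q h * ∑ y, b s y else 0)
        = (1 - α) * q h * ∑ s, if h s = z then ∑ y, b s y else 0 := fun z => by
      rw [Finset.mul_sum]
      exact Finset.sum_congr rfl fun s _ => by split_ifs <;> simp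
    have h2 : ∑ z, ∑ s, (if h s = z then ∑ y, b s y else 0) = 1 := by
      rw [Finset.sum_comm]
      simpa using hb1
    simp only [h1, Real.negMulLog_mul (_ * _) (∑ s, _), Finset.sum_add_distrib,
      ← Finset.mul_sum, ← Finset.sum_mul, h2, imageEntropy]
    ring

end Erasure

/-- **second lower bound on utility in Theorem 1.** Let `S, Z, W` have joint
distribution `μ = P_{S,Z,W}`, `H(S) > 0`, `0 ≤ ε ≤ H(S)` and `α = ε / H(S)`.  Then there
exists `U` (on a probability space carrying a copy of `(S,Z,W)`), generated from `(S,Z)`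
(i.e. `I(U;W|S,Z) = 0`), such that `I(U;S) = ε` and
`I(U;W) ≥ L²(ε) := H(Z|S) − α·H(S|Z) + ε − (1−α)·(log(I(S;Z)+1) + 4) − H(Z|W)`. -/
theorem second_lower_bound_utility
    {σ ζ τ : Type} [Fintype σ] [MeasurableSpace σ] [MeasurableSingletonClass σ]
    [Fintype ζ] [MeasurableSpace ζ] [MeasurableSingletonClass ζ]
    [Fintype τ] [MeasurableSpace τ] [MeasurableSingletonClass τ]
    (μ : Measure (σ × ζ × τ)) [IsProbabilityMeasure μ]
    (hHS : 0 < infH μ (fun p => p.1))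
    {ε : ℝ} (hε : 0 ≤ ε) (hεH : ε ≤ infH μ (fun p => p.1)) :
    ∃ (Ω : Type) (_ : MeasurableSpace Ω) (P : Measure Ω) (_ : IsProbabilityMeasure P)
      (Sv : Ω → σ) (Zv : Ω → ζ) (Wv : Ω → τ) (n : ℕ) (U : Ω → Fin n),
      Measurable Sv ∧ Measurable Zv ∧ Measurable Wv ∧ Measurable U ∧
      P.map (fun ω => (Sv ω, Zv ω, Wv ω)) = μ ∧
      infCMI P U Wv (fun ω => (Sv ω, Zv ω)) = 0 ∧
      infMI P U Sv = ε ∧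
      infMI P U Wv ≥
        infCondH μ (fun p => p.2.1) (fun p => p.1)
          - (ε / infH μ (fun p => p.1)) * infCondH μ (fun p => p.1) (fun p => p.2.1) + ε
          - (1 - ε / infH μ (fun p => p.1))
            * (Real.log (infMI μ (fun p => p.1) (fun p => p.2.1) + 1) + 4)
          - infCondH μ (fun p => p.2.1) (fun p => p.2.2) := by
  classical
  set HS := infH μ (fun p => p.1) with hHS_def
  have hα : 0 ≤ ε / HS := div_nonneg hε hHS.le
  have hα1 : ε / HS ≤ 1 := (div_le_one hHS).2 hεH
  have hαH : ε / HS * HS = ε := div_mul_cancel₀ ε hHS.ne'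
  generalize ε / HS = α at hα hα1 hαH ⊢
  obtain ⟨b, hb⟩ : ∃ b : σ → ζ → ℝ, ∀ s z, b s z = ∑ w, μ.real {(s, z, w)} := ⟨_, fun _ _ => rfl⟩
  have hb0 : ∀ s z, 0 ≤ b s z := fun s z => by
    rw [hb]
    exact Finset.sum_nonneg fun w _ => measureReal_nonneg
  obtain ⟨hb1, hS, hZ, hSZ, hZS⟩ := infH_marginals μ hb
  obtain ⟨p, q, hp, hpb, hq, hq1, hqp, hbound⟩ := exists_functional_representation
    (I := infMI μ (fun p => p.1) (fun p => p.2.1)) hb0 hb1 (by rw [infMI, hS, hZ, hSZ])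
  let e := Fintype.equivFin ((σ × ζ) ⊕ (σ → ζ))
  obtain ⟨Ω, mΩ, P, hP, Sv, Zv, Wv, U, hSv, hZv, hWv, hU, hmap, hcmi, hUS, hUW⟩ :=
    exists_channel_output μ (κ := fun i => erasureChannel α p q (e.symm i))
      (fun i => erasureChannel_nonneg hα hα1 hp hq (e.symm i)) hb fun s z hsz => by
        rw [Equiv.sum_comp e.symm fun v => erasureChannel α p q v s z]
        refine sum_erasureChannel hqp fun h0 => hsz ?_
        rw [← hpb, h0, mul_zero]
  rw [Equiv.sum_comp e.symm fun v =>
      Real.negMulLog (∑ s, ∑ z, erasureChannel α p q v s z * b s z),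
    sum_negMulLog_erasureChannel hb1 hq hqp hpb] at hUS hUW
  rw [Equiv.sum_comp e.symm fun v =>
      ∑ s, Real.negMulLog (∑ z, erasureChannel α p q v s z * b s z),
    sum_negMulLog_erasureChannel_left hb1 hq hq1 hqp hpb, ← hS] at hUS
  rw [Equiv.sum_comp e.symm fun v =>
      ∑ z, Real.negMulLog (∑ s, erasureChannel α p q v s z * b s z),
    sum_negMulLog_erasureChannel_right hb1 hq hqp hpb] at hUW
  refine ⟨Ω, mΩ, P, hP, Sv, Zv, Wv, _, U, hSv, hZv, hWv, hU, hmap, hcmi, ?_, ?_⟩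
  · rw [hUS, ← hHS_def]
    linarith
  · have hscaled := mul_le_mul_of_nonneg_left hbound (sub_nonneg.2 hα1)
    have hI : infMI μ (fun p => p.1) (fun p => p.2.1)
        = HS + infH μ (fun p => p.2.1) - infH μ (fun p => (p.1, p.2.1)) := rfl
    have hZgS : infCondH μ (fun p => p.2.1) (fun p => p.1)
        = infH μ (fun p => (p.1, p.2.1)) - HS := by
      rw [infCondH, hZS, hSZ]
    have hSgZ : infCondH μ (fun p => p.1) (fun p => p.2.1)
        = infH μ (fun p => (p.1, p.2.1)) - infH μ (fun p => p.2.1) := rfl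
    rw [hZgS, hSgZ]
    rw [mul_add, show (1 - α) * infMI μ (fun p => p.1) (fun p => p.2.1)
      = (1 - α) * (HS + infH μ (fun p => p.2.1) - infH μ (fun p => (p.1, p.2.1))) by rw [hI]]
      at hscaled
    linarith
end

section
/- Let S, Z, W be random variables on finite alphabets, where Z plays the role of the semantic f(X) and W the role of the task h(X), and let ε satisfy 0 ≤ ε ≤ H(S). If H(S|Z) = 0 (the private data S is a deterministic function of the semantic Z), then the best achievable utility is sandwiched as H(Z|S) + ε − H(Z|W) ≤ sup_{U: I(U;S) ≤ ε} I(U;W) ≤ H(Z|S) + ε + H(W|Z), where the supremum is over U generated from (S,Z); hence the gap between the upper and lower bounds on the user's utility is exactly H(Z|W) + H(W|Z). -/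
open MeasureTheory ProbabilityTheory

/-- The best achievable utility: the supremum of `I(U;W)` over all random variables `U`
(with finite alphabet) defined on some probability space carrying a copy of `(S,Z,W)` with
joint distribution `μ`, generated from `(S,Z)` (so that `U — (S,Z) — W` is a Markov chain,
i.e. `I(U;W|S,Z) = 0`), subject to the leakage constraint `I(U;S) ≤ ε`. -/
noncomputable def uEps {σ ζ τ : Type}
    [Fintype σ] [MeasurableSpace σ] [MeasurableSingletonClass σ]
    [Fintype ζ] [MeasurableSpace ζ] [MeasurableSingletonClass ζ]
    [Fintype τ] [MeasurableSpace τ] [MeasurableSingletonClass τ]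
    (μ : Measure (σ × ζ × τ)) (ε : ℝ) : ℝ :=
  sSup { r : ℝ | ∃ (Ω : Type) (_ : MeasurableSpace Ω) (P : Measure Ω)
    (_ : IsProbabilityMeasure P) (Sv : Ω → σ) (Zv : Ω → ζ) (Wv : Ω → τ)
    (n : ℕ) (U : Ω → Fin n),
    Measurable Sv ∧ Measurable Zv ∧ Measurable Wv ∧ Measurable U ∧
    P.map (fun ω => (Sv ω, Zv ω, Wv ω)) = μ ∧
    infCMI P U Wv (fun ω => (Sv ω, Zv ω)) = 0 ∧
    infMI P U Sv ≤ ε ∧ r = infMI P U Wv }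

section FiniteEntropy

variable {α β γ δ : Type*} [Fintype α]

open Classical in
/-- The push-forward of the mass function `p` along `f`. -/
noncomputable def marginal (p : α → ℝ) (f : α → β) (b : β) : ℝ :=
  ∑ a with f a = b, p a

/-- The entropy of `f` under the mass function `p`, as an expectation over `α`. -/
noncomputable def finEntropy (p : α → ℝ) (f : α → β) : ℝ :=
  -∑ a, p a * Real.log (marginal p f (f a))

lemma sum_mul_comp_eq_sum_marginal [Fintype β] (p : α → ℝ) (f : α → β) (F : β → ℝ) :
    ∑ a, p a * F (f a) = ∑ b, marginal p f b * F b := by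
  classical
  rw [← Finset.sum_fiberwise Finset.univ f]
  refine Finset.sum_congr rfl fun b _ => ?_
  rw [marginal, Finset.sum_mul]
  refine Finset.sum_congr (by congr) fun a ha => ?_
  rw [(Finset.mem_filter.1 ha).2]

lemma marginal_nonneg {p : α → ℝ} (hp : ∀ a, 0 ≤ p a) (f : α → β) (b : β) :
    0 ≤ marginal p f b :=
  Finset.sum_nonneg fun a _ => hp a

lemma le_marginal {p : α → ℝ} (hp : ∀ a, 0 ≤ p a) (f : α → β) (a : α) :
    p a ≤ marginal p f (f a) := by
  classical
  exact Finset.single_le_sum (f := p) (fun a _ => hp a) (by simp)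

lemma marginal_le_marginal {p : α → ℝ} (hp : ∀ a, 0 ≤ p a) {f : α → β} {g : α → γ} {a : α}
    (h : ∀ b, 0 < p b → f b = f a → g b = g a) :
    marginal p f (f a) ≤ marginal p g (g a) := by
  classical
  unfold marginal
  rw [Finset.sum_filter, Finset.sum_filter]
  refine Finset.sum_le_sum fun b _ => ?_
  rcases (hp b).eq_or_lt with hb | hb
  · simp [← hb]
  · by_cases hf : f b = f a
    · simp [hf, h b hb hf]
    · simp only [hf, if_false]
      split_ifs
      exacts [hb.le, le_rfl]

lemma sum_marginal_prod [Fintype β] (p : α → ℝ) (f : α → β) (h : α → γ) (c : γ) :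
    ∑ b, marginal p (fun a => (f a, h a)) (b, c) = marginal p h c := by
  classical
  unfold marginal
  rw [← Finset.sum_fiberwise (Finset.univ.filter fun a => h a = c) f]
  refine Finset.sum_congr rfl fun b _ => ?_
  rw [Finset.filter_filter]
  refine Finset.sum_congr ?_ fun _ _ => rfl
  ext a
  simp [and_comm]

lemma finEntropy_mono {p : α → ℝ} (hp : ∀ a, 0 ≤ p a) {f : α → β} {g : α → γ}
    (h : ∀ a b, 0 < p a → 0 < p b → f a = f b → g a = g b) :
    finEntropy p g ≤ finEntropy p f := by
  refine neg_le_neg (Finset.sum_le_sum fun a _ => ?_)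
  rcases (hp a).eq_or_lt with ha | ha
  · simp [← ha]
  · exact mul_le_mul_of_nonneg_left (Real.log_le_log (ha.trans_le (le_marginal hp f a))
      (marginal_le_marginal hp fun b hb => h b a hb ha)) ha.le

lemma finEntropy_congr {p : α → ℝ} (hp : ∀ a, 0 ≤ p a) {f : α → β} {g : α → γ}
    (h : ∀ a b, 0 < p a → 0 < p b → (f a = f b ↔ g a = g b)) :
    finEntropy p f = finEntropy p g :=
  le_antisymm (finEntropy_mono hp fun a b ha hb => (h a b ha hb).2)
    (finEntropy_mono hp fun a b ha hb => (h a b ha hb).1)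

lemma finEntropy_submodular [Fintype β] [Fintype γ] [Fintype δ] {p : α → ℝ}
    (hp : ∀ a, 0 ≤ p a) (f : α → β) (g : α → γ) (h : α → δ) :
    finEntropy p (fun a => (f a, g a, h a)) + finEntropy p h
      ≤ finEntropy p (fun a => (f a, h a)) + finEntropy p (fun a => (g a, h a)) := by
  set mfgh := marginal p (fun a => (f a, g a, h a)) with hmfgh
  set mfh := marginal p (fun a => (f a, h a)) with hmfh
  set mgh := marginal p (fun a => (g a, h a)) with hmgh
  set mh := marginal p h with hmh
  let F : β × γ × δ → ℝ := fun x => mfh (x.1, x.2.2) * mgh x.2 / (mfgh x * mh x.2.2)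
  have hmass : ∑ x, mfgh x * F x ≤ ∑ a, p a := by
    calc ∑ x, mfgh x * F x
        ≤ ∑ x : β × γ × δ, mfh (x.1, x.2.2) * mgh x.2 / mh x.2.2 := by
          refine Finset.sum_le_sum fun x _ => ?_
          have hq : 0 ≤ mfh (x.1, x.2.2) * mgh x.2 / mh x.2.2 :=
            div_nonneg (mul_nonneg (marginal_nonneg hp _ _) (marginal_nonneg hp _ _))
              (marginal_nonneg hp _ _)
          by_cases h0 : mfgh x = 0
          · simpa [h0] using hq
          · refine le_of_eq ?_
            simp only [F]
            rw [← div_div, div_right_comm, mul_div_cancel₀ _ h0]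
      _ = ∑ c, mh c := by
          rw [Fintype.sum_prod_type]
          simp_rw [Fintype.sum_prod_type_right]
          rw [Finset.sum_comm]
          refine Finset.sum_congr rfl fun c _ => ?_
          simp_rw [← Finset.sum_div, ← Finset.mul_sum, ← Finset.sum_mul]
          rw [hmfh, hmgh, sum_marginal_prod, sum_marginal_prod, ← hmh, mul_self_div_self]
      _ = ∑ a, p a := by
          simpa using (sum_mul_comp_eq_sum_marginal p h fun _ => 1).symm
  have hterm : ∀ a, p a - p a * F (f a, g a, h a) ≤
      p a * Real.log (mfgh (f a, g a, h a)) + p a * Real.log (mh (h a))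
        - p a * Real.log (mfh (f a, h a)) - p a * Real.log (mgh (g a, h a)) := by
    intro a
    rcases (hp a).eq_or_lt with ha | ha
    · simp [← ha]
    · have h1 : 0 < mfgh (f a, g a, h a) :=
        ha.trans_le (le_marginal hp (fun a => (f a, g a, h a)) a)
      have h2 : 0 < mfh (f a, h a) := ha.trans_le (le_marginal hp (fun a => (f a, h a)) a)
      have h3 : 0 < mgh (g a, h a) := ha.trans_le (le_marginal hp (fun a => (g a, h a)) a)
      have h4 : 0 < mh (h a) := ha.trans_le (le_marginal hp h a)
      have hlog := Real.log_le_sub_one_of_pos (div_pos (mul_pos h2 h3) (mul_pos h1 h4))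
      rw [Real.log_div (by positivity) (by positivity), Real.log_mul h2.ne' h3.ne',
        Real.log_mul h1.ne' h4.ne'] at hlog
      simp only [F]
      nlinarith [mul_le_mul_of_nonneg_left hlog ha.le]
  have hsum := Finset.sum_le_sum fun a (_ : a ∈ Finset.univ) => hterm a
  simp only [Finset.sum_sub_distrib, Finset.sum_add_distrib] at hsum
  rw [sum_mul_comp_eq_sum_marginal p (fun a => (f a, g a, h a)) F] at hsum
  simp only [finEntropy, ← hmfgh, ← hmfh, ← hmgh, ← hmh]
  linarith

lemma eq_of_finEntropy_prod_eq {p : α → ℝ} (hp : ∀ a, 0 ≤ p a) {f : α → β} {g : α → γ}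
    (h : finEntropy p (fun a => (f a, g a)) = finEntropy p g) {a b : α} (ha : 0 < p a)
    (hb : 0 < p b) (hg : g a = g b) : f a = f b := by
  classical
  have hle : ∀ c, 0 < p c →
      marginal p (fun a => (f a, g a)) (f c, g c) ≤ marginal p g (g c) := fun c _ =>
    marginal_le_marginal (f := fun a => (f a, g a)) hp fun _ _ he => (Prod.ext_iff.1 he).2
  have hterm : ∀ c ∈ Finset.univ, p c * Real.log (marginal p (fun a => (f a, g a)) (f c, g c))
      ≤ p c * Real.log (marginal p g (g c)) := by
    intro c _
    rcases (hp c).eq_or_lt with hc | hc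
    · simp [← hc]
    · exact mul_le_mul_of_nonneg_left (Real.log_le_log
        (hc.trans_le (le_marginal hp (fun a => (f a, g a)) c)) (hle c hc)) hc.le
  have heq := (Finset.sum_eq_sum_iff_of_le hterm).1 (neg_injective h) a (Finset.mem_univ a)
  have hm : marginal p (fun a => (f a, g a)) (f a, g a) = marginal p g (g a) :=
    Real.log_injOn_pos (ha.trans_le (le_marginal hp (fun a => (f a, g a)) a))
      (ha.trans_le (le_marginal hp g a)) (mul_left_cancel₀ ha.ne' heq)
  by_contra hne
  refine hm.not_lt (Finset.sum_lt_sum_of_subset (i := b) ?_ ?_ ?_ hb fun c _ _ => hp c)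
  · intro c
    simp only [Finset.mem_filter, Finset.mem_univ, true_and, Prod.mk.injEq]
    exact And.right
  · simpa using hg.symm
  · simpa using fun h => absurd h.symm hne

end FiniteEntropy

section Bridge

variable {Ω : Type*} [MeasurableSpace Ω] {α β : Type*} [Fintype α]
  [MeasurableSpace α] [MeasurableSingletonClass α]

lemma measureReal_preimage_comp (P : Measure Ω) [IsFiniteMeasure P] {X : Ω → α}
    (hX : Measurable X) (f : α → β) (b : β) :
    P.real ((fun ω => f (X ω)) ⁻¹' {b}) = marginal (fun a => P.real (X ⁻¹' {a})) f b := by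
  classical
  rw [marginal, sum_measureReal_preimage_singleton _ fun a _ => hX (measurableSet_singleton a)]
  congr 1
  ext ω
  simp

lemma infH_comp_eq_finEntropy [Fintype β] (P : Measure Ω) [IsFiniteMeasure P] {X : Ω → α}
    (hX : Measurable X) (f : α → β) :
    infH P (fun ω => f (X ω)) = finEntropy (fun a => P.real (X ⁻¹' {a})) f := by
  rw [finEntropy, sum_mul_comp_eq_sum_marginal _ f fun b => Real.log (marginal _ f b),
    ← Finset.sum_neg_distrib]
  refine Finset.sum_congr rfl fun b _ => ?_
  rw [← measureReal_preimage_comp P hX, Real.negMulLog, neg_mul]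
  rfl

lemma infH_map [Fintype β] (P : Measure Ω) {X : Ω → α} (hX : Measurable X) (f : α → β) :
    infH (P.map X) f = infH P (fun ω => f (X ω)) := by
  refine Finset.sum_congr rfl fun b _ => ?_
  rw [Measure.map_apply hX (Set.toFinite _).measurableSet]
  rfl

lemma exists_measure_real_singleton {p : α → ℝ} (hp : ∀ a, 0 ≤ p a) (h1 : ∑ a, p a = 1) :
    ∃ P : Measure α, IsProbabilityMeasure P ∧ ∀ a, P.real {a} = p a := by
  classical
  refine ⟨∑ a, ENNReal.ofReal (p a) • Measure.dirac a, ⟨?_⟩, fun a => ?_⟩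
  · simp [← ENNReal.ofReal_sum_of_nonneg fun a _ => hp a, h1]
  · simp [Measure.real, Set.indicator_apply, hp a]

end Bridge

section Upper

variable {σ ζ τ : Type} [Fintype σ] [MeasurableSpace σ] [MeasurableSingletonClass σ]
  [Fintype ζ] [MeasurableSpace ζ] [MeasurableSingletonClass ζ]
  [Fintype τ] [MeasurableSpace τ] [MeasurableSingletonClass τ]

lemma infMI_le_of_markov {Ω : Type*} [MeasurableSpace Ω] (P : Measure Ω)
    [IsProbabilityMeasure P] {Sv : Ω → σ} {Zv : Ω → ζ} {Wv : Ω → τ} {n : ℕ} {U : Ω → Fin n}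
    (hS : Measurable Sv) (hZ : Measurable Zv) (hW : Measurable Wv) (hU : Measurable U)
    (hM : infCMI P U Wv (fun ω => (Sv ω, Zv ω)) = 0) :
    infMI P U Wv ≤ infCondH P Zv Sv + infMI P U Sv + infCondH P Wv Zv := by
  have hX : Measurable fun ω => (U ω, Sv ω, Zv ω, Wv ω) := by fun_prop
  set p := fun a => P.real ((fun ω => (U ω, Sv ω, Zv ω, Wv ω)) ⁻¹' {a})
  have hp : ∀ a, 0 ≤ p a := fun a => measureReal_nonneg
  simp only [infMI, infCMI, infCondH] at hM ⊢
  have e (β : Type) [Fintype β] (f : Fin n × σ × ζ × τ → β) :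
      infH P (fun ω => f (U ω, Sv ω, Zv ω, Wv ω)) = finEntropy p f :=
    infH_comp_eq_finEntropy P hX f
  have eU := e _ fun a => a.1
  have eS := e _ fun a => a.2.1
  have eZ := e _ fun a => a.2.2.1
  have eW := e _ fun a => a.2.2.2
  have eUW := e _ fun a => (a.1, a.2.2.2)
  have eUS := e _ fun a => (a.1, a.2.1)
  have eZS := e _ fun a => (a.2.2.1, a.2.1)
  have eSZ := e _ fun a => (a.2.1, a.2.2.1)
  have eWZ := e _ fun a => (a.2.2.2, a.2.2.1)
  have eUSZ := e _ fun a => (a.1, a.2.1, a.2.2.1)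
  have eWSZ := e _ fun a => (a.2.2.2, a.2.1, a.2.2.1)
  have eUWSZ := e _ fun a => ((a.1, a.2.2.2), a.2.1, a.2.2.1)
  dsimp only at eU eS eZ eW eUW eUS eZS eSZ eWZ eUSZ eWSZ eUWSZ
  rw [eUSZ, eWSZ, eUWSZ, eSZ] at hM
  rw [eUW, eUS, eZS, eWZ, eU, eS, eZ, eW]
  have i1 := finEntropy_submodular hp (fun a => a.1) (fun a => (a.2.1, a.2.2.1))
    fun a => a.2.2.2
  have c1 : finEntropy p (fun a => (a.1, (a.2.1, a.2.2.1), a.2.2.2))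
      = finEntropy p (fun a => ((a.1, a.2.2.2), a.2.1, a.2.2.1)) :=
    finEntropy_congr hp fun a b _ _ => by simp only [Prod.mk.injEq]; tauto
  have c2 : finEntropy p (fun a => ((a.2.1, a.2.2.1), a.2.2.2))
      = finEntropy p (fun a => (a.2.2.2, a.2.1, a.2.2.1)) :=
    finEntropy_congr hp fun a b _ _ => by simp only [Prod.mk.injEq]; tauto
  have c3 : finEntropy p (fun a => (a.2.2.1, a.2.1))
      = finEntropy p (fun a => (a.2.1, a.2.2.1)) :=
    finEntropy_congr hp fun a b _ _ => by simp only [Prod.mk.injEq]; tauto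
  have m1 : finEntropy p (fun a => a.2.2.1) ≤ finEntropy p (fun a => (a.2.2.2, a.2.2.1)) :=
    finEntropy_mono hp fun a b _ _ => by simp only [Prod.mk.injEq]; tauto
  have m2 : finEntropy p (fun a => (a.1, a.2.1))
      ≤ finEntropy p (fun a => (a.1, a.2.1, a.2.2.1)) :=
    finEntropy_mono hp fun a b _ _ => by simp only [Prod.mk.injEq]; tauto
  linarith

end Upper

section Lower

lemma exists_conditional {σ ζ : Type*} [Fintype σ] [Fintype ζ] {t : σ → ζ → ℝ}
    (h0 : ∀ s z, 0 ≤ t s z) (h1 : ∑ s, ∑ z, t s z = 1) :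
    ∃ K : σ → ζ → ℝ, (∀ s z, 0 ≤ K s z) ∧ (∀ s, ∑ z, K s z = 1) ∧
      ∀ s z, (∑ z', t s z') * K s z = t s z := by
  classical
  refine ⟨fun s z => if ∑ z', t s z' = 0 then ∑ s', t s' z else t s z / ∑ z', t s z',
    fun s z => ?_, fun s => ?_, fun s z => ?_⟩
  · dsimp only
    split_ifs
    · exact Finset.sum_nonneg fun _ _ => h0 _ _
    · exact div_nonneg (h0 _ _) (Finset.sum_nonneg fun _ _ => h0 _ _)
  · by_cases h : ∑ z', t s z' = 0
    · simp only [h, if_true]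
      rw [Finset.sum_comm, h1]
    · simp only [h, if_false]
      rw [← Finset.sum_div, div_self h]
  · by_cases h : ∑ z', t s z' = 0
    · rw [h, zero_mul,
        (Finset.sum_eq_zero_iff_of_nonneg fun z _ => h0 s z).1 h z (Finset.mem_univ z)]
    · simp only [h, if_false]
      rw [mul_div_cancel₀ _ h]

/-- Functional representation: a kernel `R` from `(S, Z)` producing a random function `V`
that is independent of `S` (with law `Q`) and satisfies `V S = Z`. -/
lemma exists_functional_representation_s15 {σ ζ : Type*} [Fintype σ] [DecidableEq σ] [Fintype ζ]
    {t : σ → ζ → ℝ} (h0 : ∀ s z, 0 ≤ t s z) (h1 : ∑ s, ∑ z, t s z = 1) :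
    ∃ (R : σ → ζ → (σ → ζ) → ℝ) (Q : (σ → ζ) → ℝ), (∀ s z v, 0 ≤ R s z v) ∧
      (∀ s z, ∑ v, R s z v = 1) ∧ (∀ s z v, R s z v ≠ 0 → v s = z) ∧
      ∀ s v, ∑ z, t s z * R s z v = (∑ z, t s z) * Q v := by
  classical
  obtain ⟨K, hK0, hK1, hK⟩ := exists_conditional h0 h1
  refine ⟨fun s z v => ∏ s', if s' = s then (if v s' = z then 1 else 0) else K s' (v s'),
    fun v => ∏ s', K s' (v s'), fun s z v => ?_, fun s z => ?_, fun s z v => ?_,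
    fun s v => ?_⟩
  · refine Finset.prod_nonneg fun s' _ => ?_
    split_ifs
    exacts [zero_le_one, le_rfl, hK0 _ _]
  · rw [← Fintype.piFinset_univ, ← Finset.prod_univ_sum (fun _ => Finset.univ)
      fun s' y => if s' = s then (if y = z then (1 : ℝ) else 0) else K s' y]
    refine Finset.prod_eq_one fun s' _ => ?_
    split_ifs
    · simp
    · exact hK1 s'
  · intro h
    by_contra hne
    exact h (Finset.prod_eq_zero (Finset.mem_univ s) (by simp [hne]))
  · have hR : ∀ z, (∏ s', if s' = s then (if v s' = z then (1 : ℝ) else 0) else K s' (v s'))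
        = (if v s = z then 1 else 0) * ∏ s' ∈ Finset.univ.erase s, K s' (v s') := by
      intro z
      rw [← Finset.mul_prod_erase _ _ (Finset.mem_univ s), if_pos rfl]
      congr 1
      exact Finset.prod_congr rfl fun s' hs' => if_neg (Finset.ne_of_mem_erase hs')
    simp only [hR]
    rw [← Finset.mul_prod_erase _ _ (Finset.mem_univ s), ← mul_assoc, hK]
    simp

variable {σ ζ τ υ : Type*}

/-- The joint mass function of `(U, S, Z, W)` when `U` is drawn from `(S, Z)` by `q`. -/
def jointMass (r : σ × ζ × τ → ℝ) (q : υ → σ → ζ → ℝ) (a : υ × σ × ζ × τ) : ℝ :=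
  r a.2 * q a.1 a.2.1 a.2.2.1

lemma jointMass_nonneg {r : σ × ζ × τ → ℝ} {q : υ → σ → ζ → ℝ} (hr : ∀ y, 0 ≤ r y)
    (hq : ∀ u s z, 0 ≤ q u s z) (a : υ × σ × ζ × τ) : 0 ≤ jointMass r q a :=
  mul_nonneg (hr _) (hq _ _ _)

lemma pos_of_jointMass_pos {r : σ × ζ × τ → ℝ} {q : υ → σ → ζ → ℝ} (hr : ∀ y, 0 ≤ r y)
    (hq : ∀ u s z, 0 ≤ q u s z) {a : υ × σ × ζ × τ} (ha : 0 < jointMass r q a) :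
    0 < r a.2 ∧ 0 < q a.1 a.2.1 a.2.2.1 :=
  ⟨(hr _).lt_of_ne' (left_ne_zero_of_mul ha.ne'),
    (hq _ _ _).lt_of_ne' (right_ne_zero_of_mul ha.ne')⟩

variable [Fintype σ] [Fintype ζ] [Fintype τ] [Fintype υ]

lemma sum_jointMass_mul {r : σ × ζ × τ → ℝ} {q : υ → σ → ζ → ℝ}
    (hq : ∀ s z, ∑ u, q u s z = 1) (F : σ × ζ × τ → ℝ) :
    ∑ a, jointMass r q a * F a.2 = ∑ y, r y * F y := by
  rw [Fintype.sum_prod_type_right]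
  refine Finset.sum_congr rfl fun y _ => ?_
  simp only [jointMass]
  rw [← Finset.sum_mul, ← Finset.mul_sum, hq, mul_one]

lemma marginal_jointMass_snd {β : Type*} {r : σ × ζ × τ → ℝ} {q : υ → σ → ζ → ℝ}
    (hq : ∀ s z, ∑ u, q u s z = 1) (f : σ × ζ × τ → β) (b : β) :
    marginal (jointMass r q) (fun a => f a.2) b = marginal r f b := by
  classical
  have := sum_jointMass_mul (r := r) hq fun y => if f y = b then 1 else 0
  simpa [marginal, Finset.sum_filter] using this

lemma finEntropy_jointMass_snd {β : Type*} {r : σ × ζ × τ → ℝ} {q : υ → σ → ζ → ℝ}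
    (hq : ∀ s z, ∑ u, q u s z = 1) (f : σ × ζ × τ → β) :
    finEntropy (jointMass r q) (fun a => f a.2) = finEntropy r f := by
  simp only [finEntropy, marginal_jointMass_snd hq]
  rw [sum_jointMass_mul hq fun y => Real.log (marginal r f (f y))]

lemma marginal_jointMass_prod {β : Type*} (r : σ × ζ × τ → ℝ) (q : υ → σ → ζ → ℝ)
    (f : σ × ζ × τ → β) (u : υ) (b : β) :
    marginal (jointMass r q) (fun a => (a.1, f a.2)) (u, b)
      = marginal (fun y => r y * q u y.1 y.2.1) f b := by
  classical
  simp only [marginal, Finset.sum_filter, Prod.mk.injEq, ite_and]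
  rw [Fintype.sum_prod_type_right]
  simp [jointMass]

lemma marginal_fst {β γ : Type*} [Fintype β] [Fintype γ] (p : β × γ → ℝ) (b : β) :
    marginal p (fun a => a.1) b = ∑ c, p (b, c) := by
  classical
  simp [marginal, Finset.sum_filter, Fintype.sum_prod_type_right]

lemma marginal_mul_comp {α β : Type*} [Fintype α] (p : α → ℝ) (f : α → β) (F : β → ℝ) (b : β) :
    marginal (fun a => p a * F (f a)) f b = marginal p f b * F b := by
  classical
  rw [marginal, marginal, Finset.sum_mul]
  exact Finset.sum_congr rfl fun a ha => by rw [(Finset.mem_filter.1 ha).2]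

/-- A variable drawn from `(S, Z)` is conditionally independent of `W` given `(S, Z)`. -/
lemma jointMass_markov {r : σ × ζ × τ → ℝ} {q : υ → σ → ζ → ℝ} (hr : ∀ y, 0 ≤ r y)
    (hq0 : ∀ u s z, 0 ≤ q u s z) (hq : ∀ s z, ∑ u, q u s z = 1) :
    finEntropy (jointMass r q) (fun a => (a.1, a.2.1, a.2.2.1))
        + finEntropy (jointMass r q) (fun a => (a.2.2.2, a.2.1, a.2.2.1))
      = finEntropy (jointMass r q) (fun a => ((a.1, a.2.2.2), a.2.1, a.2.2.1))
        + finEntropy (jointMass r q) (fun a => (a.2.1, a.2.2.1)) := by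
  have hp := jointMass_nonneg hr hq0
  have hc : finEntropy (jointMass r q) (fun a => ((a.1, a.2.2.2), a.2.1, a.2.2.1))
      = finEntropy (jointMass r q) (fun a => (a.1, a.2.2.2, a.2.1, a.2.2.1)) :=
    finEntropy_congr hp fun a b _ _ => by simp only [Prod.mk.injEq]; tauto
  rw [hc]
  simp only [finEntropy]
  rw [← neg_add, ← neg_add, ← Finset.sum_add_distrib, ← Finset.sum_add_distrib, neg_inj]
  refine Finset.sum_congr rfl fun a _ => ?_
  rw [← mul_add, ← mul_add]
  rcases (hp a).eq_or_lt with ha | ha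
  · simp [← ha]
  obtain ⟨hra, hqa⟩ := pos_of_jointMass_pos hr hq0 ha
  have e1 := marginal_jointMass_prod r q (fun y => (y.1, y.2.1)) a.1 (a.2.1, a.2.2.1)
  rw [marginal_mul_comp r (fun y => (y.1, y.2.1)) (fun b => q a.1 b.1 b.2)] at e1
  have e2 := marginal_jointMass_prod r q (fun y => (y.2.2, y.1, y.2.1)) a.1
    (a.2.2.2, a.2.1, a.2.2.1)
  rw [marginal_mul_comp r (fun y => (y.2.2, y.1, y.2.1)) (fun b => q a.1 b.2.1 b.2.2)] at e2
  have e3 := marginal_jointMass_snd (r := r) hq (fun y => (y.1, y.2.1)) (a.2.1, a.2.2.1)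
  have e4 := marginal_jointMass_snd (r := r) hq (fun y => (y.2.2, y.1, y.2.1))
    (a.2.2.2, a.2.1, a.2.2.1)
  have p3 := hra.trans_le (le_marginal hr (fun y => (y.1, y.2.1)) a.2)
  have p4 := hra.trans_le (le_marginal hr (fun y => (y.2.2, y.1, y.2.1)) a.2)
  rw [e1, e2, e3, e4, Real.log_mul p3.ne' hqa.ne', Real.log_mul p4.ne' hqa.ne']
  ring

/-- When `S` is a function of `Z`, there is `U` drawn from `(S, Z)` with `I(U; S) = ε` and
such that `Z` is a function of `(U, S)`. -/
lemma exists_kernel_with_leakage {σ ζ τ : Type} [Fintype σ] [Fintype ζ] [Fintype τ]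
    {r : σ × ζ × τ → ℝ} (hr : ∀ y, 0 ≤ r y) (h1 : ∑ y, r y = 1)
    (hdet : ∀ x y, 0 < r x → 0 < r y → x.2.1 = y.2.1 → x.1 = y.1)
    {ε : ℝ} (hε : 0 ≤ ε) (hεH : ε ≤ finEntropy r (fun y => y.1)) :
    ∃ (υ : Type) (_ : Fintype υ) (q : υ → σ → ζ → ℝ), (∀ u s z, 0 ≤ q u s z) ∧
      (∀ s z, ∑ u, q u s z = 1) ∧
      (∀ u s z z', 0 < q u s z → 0 < q u s z' → z = z') ∧
      finEntropy (jointMass r q) (fun a => a.1) + finEntropy (jointMass r q) (fun a => a.2.1)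
        - finEntropy (jointMass r q) (fun a => (a.1, a.2.1)) = ε := by
  classical
  obtain ⟨c, hc0, hc1, hcε⟩ : ∃ c : ℝ, 0 ≤ c ∧ c ≤ 1 ∧ c * finEntropy r (fun y => y.1) = ε := by
    rcases (hε.trans hεH).eq_or_lt with h | h
    · exact ⟨0, le_rfl, zero_le_one, by linarith⟩
    · exact ⟨ε / finEntropy r (fun y => y.1), by positivity, (div_le_one h).2 hεH,
        div_mul_cancel₀ _ h.ne'⟩
  obtain ⟨R, Q, hR0, hR1, hRdet, hRQ⟩ := exists_functional_representation_s15
    (t := fun s z => ∑ w, r (s, z, w)) (fun s z => Finset.sum_nonneg fun _ _ => hr _)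
    (by simpa [Fintype.sum_prod_type] using h1)
  have hmS : ∀ s, marginal r (fun y => y.1) s = ∑ z, ∑ w, r (s, z, w) := fun s => by
    rw [marginal_fst, Fintype.sum_prod_type]
  let q : ζ ⊕ (σ → ζ) → σ → ζ → ℝ := fun u s z =>
    u.elim (fun z' => if z = z' then c else 0) fun v => (1 - c) * R s z v
  have hq0 : ∀ u s z, 0 ≤ q u s z := by
    rintro (z' | v) s z
    · simp only [q, Sum.elim_inl]
      split_ifs
      exacts [hc0, le_rfl]
    · exact mul_nonneg (by linarith) (hR0 _ _ _)
  have hq1 : ∀ s z, ∑ u, q u s z = 1 := fun s z => by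
    simp [q, Fintype.sum_sum_type, ← Finset.mul_sum, hR1]
  have hl : ∀ {z' s z}, 0 < q (Sum.inl z') s z → z = z' := fun {z' s z} h => by
    by_contra hne
    simp [q, hne] at h
  have hp := jointMass_nonneg hr hq0
  refine ⟨ζ ⊕ (σ → ζ), inferInstance, q, hq0, hq1, ?_, ?_⟩
  · rintro (z₀ | v) s z z' h h'
    · rw [hl h, hl h']
    · rw [← hRdet s z v (right_ne_zero_of_mul h.ne'), ← hRdet s z' v (right_ne_zero_of_mul h'.ne')]
  have hsS : ∀ s, marginal (jointMass r q) (fun a => a.2.1) s = marginal r (fun y => y.1) s :=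
    marginal_jointMass_snd hq1 fun y => y.1
  have hUS : ∀ v s, marginal (jointMass r q) (fun a => (a.1, a.2.1)) (Sum.inr v, s)
      = marginal r (fun y => y.1) s * ((1 - c) * Q v) := fun v s => by
    rw [marginal_jointMass_prod r q (fun y => y.1), marginal_fst, hmS, Fintype.sum_prod_type]
    simp only [q, Sum.elim_inr]
    rw [mul_left_comm, ← hRQ s v, Finset.mul_sum]
    refine Finset.sum_congr rfl fun z _ => ?_
    rw [← Finset.sum_mul]
    ring
  have hU : ∀ v, marginal (jointMass r q) (fun a => a.1) (Sum.inr v) = (1 - c) * Q v := fun v => by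
    rw [marginal_fst, Fintype.sum_prod_type]
    have h : ∀ s, ∑ y : ζ × τ, jointMass r q (Sum.inr v, s, y)
        = marginal r (fun y => y.1) s * ((1 - c) * Q v) := fun s => by
      rw [← hUS, marginal_jointMass_prod r q (fun y => y.1), marginal_fst]
      rfl
    simp_rw [h]
    rw [← Finset.sum_mul]
    simp_rw [marginal_fst]
    rw [← Fintype.sum_prod_type, h1, one_mul]
  have hterm : ∀ a, jointMass r q a * Real.log (marginal (jointMass r q) (fun a => (a.1, a.2.1))
        (a.1, a.2.1)) - jointMass r q a * Real.log (marginal (jointMass r q) (fun a => a.1) a.1)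
        - jointMass r q a * Real.log (marginal (jointMass r q) (fun a => a.2.1) a.2.1)
      = jointMass r q a * (if a.1.isLeft then -Real.log (marginal r (fun y => y.1) a.2.1) else 0) := by
    intro a
    rcases (hp a).eq_or_lt with ha | ha
    · simp [← ha]
    have hS := ha.trans_le (le_marginal hp (fun a => a.2.1) a)
    have hUpos := ha.trans_le (le_marginal hp (fun a => a.1) a)
    rw [hsS] at hS ⊢
    obtain ⟨z' | v, y⟩ := a
    · have he : marginal (jointMass r q) (fun a => (a.1, a.2.1)) (Sum.inl z', y.1)
          = marginal (jointMass r q) (fun a => a.1) (Sum.inl z') := by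
        refine le_antisymm
          (marginal_le_marginal (f := fun a => (a.1, a.2.1)) (g := fun a => a.1)
            (a := (Sum.inl z', y)) hp fun b _ h => (Prod.ext_iff.1 h).1)
          (marginal_le_marginal (f := fun a => a.1) (g := fun a => (a.1, a.2.1))
            (a := (Sum.inl z', y)) hp ?_)
        rintro ⟨u, y'⟩ hb rfl
        obtain ⟨h2, h3⟩ := pos_of_jointMass_pos hr hq0 hb
        obtain ⟨h4, h5⟩ := pos_of_jointMass_pos hr hq0 ha
        exact Prod.ext rfl (hdet _ _ h2 h4 ((hl h3).trans (hl h5).symm))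
      simp only [he, Sum.isLeft_inl, if_true]
      ring
    · simp only [hUS, hU] at hUpos ⊢
      rw [Real.log_mul hS.ne' hUpos.ne']
      simp only [Sum.isLeft_inr, Bool.false_eq_true, if_false]
      ring
  have hsum := Finset.sum_congr rfl fun a (_ : a ∈ Finset.univ) => hterm a
  simp only [Finset.sum_sub_distrib] at hsum
  have hrhs : ∑ a, jointMass r q a *
      (if a.1.isLeft then -Real.log (marginal r (fun y => y.1) a.2.1) else 0) = ε := by
    rw [← hcε, finEntropy, Fintype.sum_prod_type_right, ← Finset.sum_neg_distrib, Finset.mul_sum]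
    refine Finset.sum_congr rfl fun y _ => ?_
    simp only [Fintype.sum_sum_type, jointMass, q, Sum.elim_inl, Sum.isLeft_inl, Sum.isLeft_inr,
      if_true, Bool.false_eq_true, if_false, mul_zero, Finset.sum_const_zero, add_zero, mul_ite,
      ite_mul, zero_mul, Finset.sum_ite_eq, Finset.mem_univ]
    ring
  simp only [finEntropy]
  linarith

end Lower

section Sandwich

variable {σ ζ τ : Type} [Fintype σ] [MeasurableSpace σ] [MeasurableSingletonClass σ]
  [Fintype ζ] [MeasurableSpace ζ] [MeasurableSingletonClass ζ]
  [Fintype τ] [MeasurableSpace τ] [MeasurableSingletonClass τ]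

lemma infH_eq_finEntropy {β : Type*} [Fintype β] (μ : Measure (σ × ζ × τ)) [IsFiniteMeasure μ]
    (f : σ × ζ × τ → β) : infH μ f = finEntropy (fun y => μ.real {y}) f :=
  infH_comp_eq_finEntropy μ measurable_id f

lemma infMI_le_of_map_eq {μ : Measure (σ × ζ × τ)} {ε : ℝ} {Ω : Type*} [MeasurableSpace Ω]
    (P : Measure Ω) [IsProbabilityMeasure P] {Sv : Ω → σ} {Zv : Ω → ζ} {Wv : Ω → τ} {n : ℕ}
    {U : Ω → Fin n} (hS : Measurable Sv) (hZ : Measurable Zv) (hW : Measurable Wv)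
    (hU : Measurable U) (hμ : P.map (fun ω => (Sv ω, Zv ω, Wv ω)) = μ)
    (hM : infCMI P U Wv (fun ω => (Sv ω, Zv ω)) = 0) (hI : infMI P U Sv ≤ ε) :
    infMI P U Wv ≤ infCondH μ (fun p => p.2.1) (fun p => p.1) + ε
      + infCondH μ (fun p => p.2.2) (fun p => p.2.1) := by
  have hX : Measurable fun ω => (Sv ω, Zv ω, Wv ω) := by fun_prop
  have h := infMI_le_of_markov P hS hZ hW hU hM
  subst hμ
  simp only [infCondH, infH_map P hX] at h ⊢
  linarith

lemma exists_utility_ge (μ : Measure (σ × ζ × τ)) [IsProbabilityMeasure μ]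
    {ε : ℝ} (hε : 0 ≤ ε) (hεH : ε ≤ infH μ (fun p => p.1))
    (hdet : infCondH μ (fun p => p.1) (fun p => p.2.1) = 0) :
    ∃ (Ω : Type) (_ : MeasurableSpace Ω) (P : Measure Ω)
      (_ : IsProbabilityMeasure P) (Sv : Ω → σ) (Zv : Ω → ζ) (Wv : Ω → τ)
      (n : ℕ) (U : Ω → Fin n),
      Measurable Sv ∧ Measurable Zv ∧ Measurable Wv ∧ Measurable U ∧
      P.map (fun ω => (Sv ω, Zv ω, Wv ω)) = μ ∧
      infCMI P U Wv (fun ω => (Sv ω, Zv ω)) = 0 ∧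
      infMI P U Sv ≤ ε ∧
      infCondH μ (fun p => p.2.1) (fun p => p.1) + ε
        - infCondH μ (fun p => p.2.1) (fun p => p.2.2) ≤ infMI P U Wv := by
  set r : σ × ζ × τ → ℝ := fun y => μ.real {y} with hr_def
  have hr : ∀ y, 0 ≤ r y := fun y => measureReal_nonneg
  have hr1 : ∑ y, r y = 1 := by
    simp [r]
  simp only [infCondH, infH_eq_finEntropy, ← hr_def] at hεH hdet ⊢
  obtain ⟨υ, _, q, hq0, hq1, hqdet, hI⟩ := exists_kernel_with_leakage hr hr1
    (fun x y hx hy h => eq_of_finEntropy_prod_eq hr (sub_eq_zero.1 hdet) hx hy h) hε hεH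
  let _ : MeasurableSpace υ := ⊤
  set p := jointMass r q with hp_def
  have hp : ∀ a, 0 ≤ p a := jointMass_nonneg hr hq0
  have hp1 : ∑ a, p a = 1 := by
    simpa [hr1] using sum_jointMass_mul (r := r) hq1 fun _ => 1
  obtain ⟨P, hP, hPp⟩ := exists_measure_real_singleton hp hp1
  have hid : (fun a => P.real (id ⁻¹' {a})) = p := funext hPp
  let e := Fintype.equivFin υ
  have hmap : P.map (fun a : υ × σ × ζ × τ => (a.2.1, a.2.2.1, a.2.2.2)) = μ := by
    refine Measure.ext_of_singleton fun y => ?_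
    rw [Measure.map_apply .of_discrete (measurableSet_singleton y),
      ← ENNReal.toReal_eq_toReal_iff' (measure_ne_top _ _) (measure_ne_top _ _)]
    have h := measureReal_preimage_comp P measurable_id (fun a : υ × σ × ζ × τ => a.2) y
    rw [hid] at h
    refine h.trans ((marginal_jointMass_snd hq1 id y).trans ?_)
    classical
    simp [marginal, Finset.filter_eq', r, Measure.real]
  have hH (β : Type) [Fintype β] (f : υ × σ × ζ × τ → β) : infH P f = finEntropy p f := by
    rw [← hid]
    exact infH_comp_eq_finEntropy P measurable_id f
  have hμ {β : Type} (f : σ × ζ × τ → β) :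
      finEntropy r f = finEntropy p (fun a => f a.2) := (finEntropy_jointMass_snd hq1 f).symm
  have cU : finEntropy p (fun a => e a.1) = finEntropy p (fun a => a.1) :=
    finEntropy_congr hp fun a b _ _ => e.injective.eq_iff
  have cUS : finEntropy p (fun a => (e a.1, a.2.1)) = finEntropy p (fun a => (a.1, a.2.1)) :=
    finEntropy_congr hp fun a b _ _ => by simp only [Prod.mk.injEq, e.injective.eq_iff]
  have cUW : finEntropy p (fun a => (e a.1, a.2.2.2)) = finEntropy p (fun a => (a.1, a.2.2.2)) :=
    finEntropy_congr hp fun a b _ _ => by simp only [Prod.mk.injEq, e.injective.eq_iff]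
  have cUSZ : finEntropy p (fun a => (e a.1, a.2.1, a.2.2.1))
      = finEntropy p (fun a => (a.1, a.2.1, a.2.2.1)) :=
    finEntropy_congr hp fun a b _ _ => by simp only [Prod.mk.injEq, e.injective.eq_iff]
  have cUWSZ : finEntropy p (fun a => ((e a.1, a.2.2.2), a.2.1, a.2.2.1))
      = finEntropy p (fun a => ((a.1, a.2.2.2), a.2.1, a.2.2.1)) :=
    finEntropy_congr hp fun a b _ _ => by simp only [Prod.mk.injEq, e.injective.eq_iff]
  refine ⟨υ × σ × ζ × τ, inferInstance, P, hP, fun a => a.2.1, fun a => a.2.2.1,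
    fun a => a.2.2.2, _, fun a => e a.1, .of_discrete, .of_discrete, .of_discrete,
    .of_discrete, hmap, ?_, ?_, ?_⟩
  · simp only [infCMI, infCondH, hH, cUSZ, cUWSZ]
    linarith [jointMass_markov hr hq0 hq1]
  · simp only [infMI, hH, cU, cUS]
    exact hI.le
  · simp only [infMI, hH, cU, cUW, hμ] at hdet ⊢
    have hZUS : finEntropy p (fun a => (a.1, a.2.2.1)) ≤ finEntropy p (fun a => (a.1, a.2.1)) := by
      refine finEntropy_mono hp ?_
      rintro ⟨u, s, z, w⟩ ⟨u', s', z', w'⟩ ha hb h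
      obtain ⟨rfl, rfl⟩ := Prod.mk.inj h
      exact Prod.ext rfl (hqdet _ _ _ _ (pos_of_jointMass_pos hr hq0 ha).2
        (pos_of_jointMass_pos hr hq0 hb).2)
    have hsub := finEntropy_submodular hp (fun a => a.1) (fun a => a.2.2.2) fun a => a.2.2.1
    have hmono : finEntropy p (fun a => (a.1, a.2.2.2))
        ≤ finEntropy p (fun a => (a.1, a.2.2.2, a.2.2.1)) :=
      finEntropy_mono hp fun a b _ _ => by simp only [Prod.mk.injEq]; tauto
    have cZS : finEntropy p (fun a => (a.2.2.1, a.2.1))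
        = finEntropy p (fun a => (a.2.1, a.2.2.1)) :=
      finEntropy_congr hp fun a b _ _ => by simp only [Prod.mk.injEq]; tauto
    have cWZ : finEntropy p (fun a => (a.2.2.2, a.2.2.1))
        = finEntropy p (fun a => (a.2.2.1, a.2.2.2)) :=
      finEntropy_congr hp fun a b _ _ => by simp only [Prod.mk.injEq]; tauto
    linarith

end Sandwich

/-- Let `S, Z, W` have joint distribution `μ = P_{S,Z,W}` and
`0 ≤ ε ≤ H(S)`.  If `H(S|Z) = 0`, the best achievable utility is sandwiched as
`H(Z|S) + ε − H(Z|W) ≤ sup_{U : I(U;S) ≤ ε} I(U;W) ≤ H(Z|S) + ε + H(W|Z)`;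
hence the gap between the two bounds is exactly `H(Z|W) + H(W|Z)`. -/
theorem utility_sandwich_when_S_determined_by_Z
    {σ ζ τ : Type} [Fintype σ] [MeasurableSpace σ] [MeasurableSingletonClass σ]
    [Fintype ζ] [MeasurableSpace ζ] [MeasurableSingletonClass ζ]
    [Fintype τ] [MeasurableSpace τ] [MeasurableSingletonClass τ]
    (μ : Measure (σ × ζ × τ)) [IsProbabilityMeasure μ]
    {ε : ℝ} (hε : 0 ≤ ε) (hεH : ε ≤ infH μ (fun p => p.1))
    (hdet : infCondH μ (fun p => p.1) (fun p => p.2.1) = 0) :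
    infCondH μ (fun p => p.2.1) (fun p => p.1) + ε
        - infCondH μ (fun p => p.2.1) (fun p => p.2.2) ≤ uEps μ ε ∧
    uEps μ ε ≤ infCondH μ (fun p => p.2.1) (fun p => p.1) + ε
        + infCondH μ (fun p => p.2.2) (fun p => p.2.1) ∧
    (infCondH μ (fun p => p.2.1) (fun p => p.1) + ε
        + infCondH μ (fun p => p.2.2) (fun p => p.2.1))
      - (infCondH μ (fun p => p.2.1) (fun p => p.1) + ε
        - infCondH μ (fun p => p.2.1) (fun p => p.2.2))
      = infCondH μ (fun p => p.2.1) (fun p => p.2.2)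
        + infCondH μ (fun p => p.2.2) (fun p => p.2.1) := by
  obtain ⟨Ω, m, P, hP, Sv, Zv, Wv, n, U, hS, hZ, hW, hU, hμ, hM, hI, hle⟩ :=
    exists_utility_ge μ hε hεH hdet
  refine ⟨hle.trans (le_csSup
    ⟨infCondH μ (fun p => p.2.1) (fun p => p.1) + ε
      + infCondH μ (fun p => p.2.2) (fun p => p.2.1), ?_⟩
    ⟨Ω, m, P, hP, Sv, Zv, Wv, n, U, hS, hZ, hW, hU, hμ, hM, hI, rfl⟩),
    csSup_le ⟨_, Ω, m, P, hP, Sv, Zv, Wv, n, U, hS, hZ, hW, hU, hμ, hM, hI, rfl⟩ ?_, by ring⟩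
  all_goals
    rintro _ ⟨_, _, P, _, _, _, _, _, _, hS, hZ, hW, hU, hμ, hM, hI, rfl⟩
    exact infMI_le_of_map_eq P hS hZ hW hU hμ hM hI
end

section
/- Let S, Z, W, U be random variables taking values in finite alphabets on a common probability space, where Z plays the role of the semantic f(X) and W the role of the task h(X). If I(U;S) ≤ ε, then I(U;W) ≤ ε + H(Z|S) + H(W) − I(Z;W). In particular, if the semantic satisfies the design constraints γ1 ≤ I(Z;W) and H(Z) ≤ γ3, then I(U;W) ≤ ε + γ3 − γ1 + H(W). (Corollary 2: an upper bound on the user's utility not depending on the semantic beyond the design constraints.) -/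
open MeasureTheory ProbabilityTheory

/-- The law of total probability over the fibres of a finitely valued random variable. -/
theorem sum_measureReal_preimage_singleton_inter {Ω α : Type*} [MeasurableSpace Ω] [Fintype α]
    [MeasurableSpace α] [MeasurableSingletonClass α] (P : Measure Ω) [IsFiniteMeasure P]
    {X : Ω → α} (hX : Measurable X) (E : Set Ω) :
    ∑ x, P.real (X ⁻¹' {x} ∩ E) = P.real E := by
  have h := sum_measureReal_preimage_singleton (μ := P.restrict E) (f := X) Finset.univ
    (fun y _ => hX (measurableSet_singleton y))
  simpa [measureReal_restrict_apply (hX (measurableSet_singleton _))] using h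

/-- The entropy of a function of `V` as an expectation over the law of `V`. -/
theorem infH_comp_eq_sum {Ω α β : Type*} [MeasurableSpace Ω] [Fintype α] [MeasurableSpace α]
    [MeasurableSingletonClass α] [Fintype β] (P : Measure Ω) [IsFiniteMeasure P]
    {V : Ω → α} (hV : Measurable V) (f : α → β) :
    infH P (fun ω => f (V ω)) =
      ∑ v, -(P.real (V ⁻¹' {v}) * Real.log (P.real ((fun ω => f (V ω)) ⁻¹' {f v}))) := by
  classical
  have hq (b : β) : P.real ((fun ω => f (V ω)) ⁻¹' {b}) =
      ∑ v, if f v = b then P.real (V ⁻¹' {v}) else 0 := by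
    rw [← sum_measureReal_preimage_singleton_inter P hV]
    refine Finset.sum_congr rfl fun v _ => ?_
    split_ifs with h
    · congr 1
      ext ω
      simp only [Set.mem_inter_iff, Set.mem_preimage, Set.mem_singleton_iff]
      grind
    · convert measureReal_empty
      ext ω
      simp only [Set.mem_inter_iff, Set.mem_preimage, Set.mem_singleton_iff,
        Set.mem_empty_iff_false]
      grind
  calc infH P (fun ω => f (V ω))
      = ∑ b, ∑ v, if f v = b then
          -(P.real (V ⁻¹' {v}) * Real.log (P.real ((fun ω => f (V ω)) ⁻¹' {b}))) else 0 := by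
        refine Finset.sum_congr rfl fun b _ => ?_
        change Real.negMulLog (P.real _) = _
        rw [Real.negMulLog, neg_mul]
        nth_rewrite 1 [hq b]
        rw [Finset.sum_mul, ← Finset.sum_neg_distrib]
        refine Finset.sum_congr rfl fun v _ => ?_
        split_ifs <;> simp
    _ = _ := by
        rw [Finset.sum_comm]
        simp

/-- Entropy does not increase under a function. -/
theorem infH_comp_le {Ω α β : Type*} [MeasurableSpace Ω] [Fintype α] [MeasurableSpace α]
    [MeasurableSingletonClass α] [Fintype β] (P : Measure Ω) [IsFiniteMeasure P]
    {V : Ω → α} (hV : Measurable V) (f : α → β) :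
    infH P (fun ω => f (V ω)) ≤ infH P V := by
  rw [infH_comp_eq_sum P hV f]
  refine Finset.sum_le_sum fun v _ => ?_
  change _ ≤ Real.negMulLog (P.real _)
  rw [Real.negMulLog, neg_mul, neg_le_neg_iff]
  rcases (measureReal_nonneg (μ := P) (s := V ⁻¹' {v})).eq_or_lt with h | h
  · simp [← h]
  · have : V ⁻¹' {v} ⊆ (fun ω => f (V ω)) ⁻¹' {f v} := fun ω hω => congrArg f hω
    have hle := measureReal_mono (μ := P) this
    gcongr

/-- A pointwise form of `log t ≤ t - 1` for a ratio `b * c / (a * d)`. -/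
theorem mul_log_add_log_sub_log_sub_log_le {a b c d : ℝ} (ha : 0 ≤ a) (hab : a ≤ b) (hac : a ≤ c)
    (had : a ≤ d) :
    a * (Real.log b + Real.log c - Real.log a - Real.log d) ≤ b * c / d - a := by
  rcases ha.eq_or_lt with rfl | ha
  · simp only [zero_mul, sub_zero]
    positivity
  have hb := ha.trans_le hab
  have hc := ha.trans_le hac
  have hd := ha.trans_le had
  have h := Real.log_le_sub_one_of_pos (show 0 < b * c / (a * d) by positivity)
  rw [Real.log_div (by positivity) (by positivity), Real.log_mul hb.ne' hc.ne',
    Real.log_mul ha.ne' hd.ne'] at h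
  calc _ = a * (Real.log b + Real.log c - (Real.log a + Real.log d)) := by ring
    _ ≤ a * (b * c / (a * d) - 1) := by gcongr
    _ = _ := by field_simp

/-- Submodularity of entropy: `H(X,Y,T) + H(T) ≤ H(X,T) + H(Y,T)`. -/
theorem infH_submodular {Ω α β γ : Type*} [MeasurableSpace Ω]
    [Fintype α] [MeasurableSpace α] [MeasurableSingletonClass α]
    [Fintype β] [MeasurableSpace β] [MeasurableSingletonClass β]
    [Fintype γ] [MeasurableSpace γ] [MeasurableSingletonClass γ]
    (P : Measure Ω) [IsFiniteMeasure P] {X : Ω → α} {Y : Ω → β} {T : Ω → γ}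
    (hX : Measurable X) (hY : Measurable Y) (hT : Measurable T) :
    infH P (fun ω => (X ω, Y ω, T ω)) + infH P T ≤
      infH P (fun ω => (X ω, T ω)) + infH P (fun ω => (Y ω, T ω)) := by
  have hV : Measurable fun ω => (X ω, Y ω, T ω) := hX.prodMk (hY.prodMk hT)
  set a : α × β × γ → ℝ := fun v => P.real ((fun ω => (X ω, Y ω, T ω)) ⁻¹' {v}) with ha
  set b : α × γ → ℝ := fun v => P.real ((fun ω => (X ω, T ω)) ⁻¹' {v}) with hb
  set c : β × γ → ℝ := fun v => P.real ((fun ω => (Y ω, T ω)) ⁻¹' {v}) with hc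
  set d : γ → ℝ := fun t => P.real (T ⁻¹' {t}) with hd
  have eT := infH_comp_eq_sum P hV (fun v => v.2.2)
  have eX := infH_comp_eq_sum P hV (fun v => (v.1, v.2.2))
  have eY := infH_comp_eq_sum P hV (fun v => v.2)
  have eV := infH_comp_eq_sum P hV (fun v => v)
  have sb (t : γ) : ∑ x, b (x, t) = d t := by
    simp only [hd]
    rw [← sum_measureReal_preimage_singleton_inter P hX]
    refine Finset.sum_congr rfl fun x _ => congrArg P.real ?_
    ext ω; simp
  have sc (t : γ) : ∑ y, c (y, t) = d t := by
    simp only [hd]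
    rw [← sum_measureReal_preimage_singleton_inter P hY]
    refine Finset.sum_congr rfl fun x _ => congrArg P.real ?_
    ext ω; simp
  have sd : ∑ t, d t = P.real Set.univ := by
    simpa using sum_measureReal_preimage_singleton_inter P hT Set.univ
  have sa : ∑ v, a v = P.real Set.univ := by
    simpa using sum_measureReal_preimage_singleton_inter P hV Set.univ
  have sbc : ∑ v : α × β × γ, b (v.1, v.2.2) * c v.2 / d v.2.2 = P.real Set.univ := by
    calc _ = ∑ t, (∑ x, b (x, t)) * (∑ y, c (y, t)) / d t := by
          simp_rw [Fintype.sum_prod_type, Finset.sum_mul_sum, Finset.sum_div]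
          simp_rw [Finset.sum_comm (s := (Finset.univ : Finset γ))]
      _ = ∑ t, d t := by simp [sb, sc, mul_self_div_self]
      _ = _ := sd
  have key : ∑ v, a v * (Real.log (b (v.1, v.2.2)) + Real.log (c v.2) - Real.log (a v)
      - Real.log (d v.2.2)) ≤ 0 := by
    calc _ ≤ ∑ v : α × β × γ, (b (v.1, v.2.2) * c v.2 / d v.2.2 - a v) := by
          refine Finset.sum_le_sum fun v _ => mul_log_add_log_sub_log_sub_log_le
            measureReal_nonneg ?_ ?_ ?_
          · exact measureReal_mono fun ω (h : _ = _) => by simp [← h]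
          · exact measureReal_mono fun ω (h : _ = _) => by simp [← h]
          · exact measureReal_mono fun ω (h : _ = _) => by simp [← h]
      _ = 0 := by rw [Finset.sum_sub_distrib, sbc, sa, sub_self]
  rw [eT, eX, eY, eV, ← sub_nonpos, ← Finset.sum_add_distrib, ← Finset.sum_add_distrib,
    ← Finset.sum_sub_distrib]
  refine le_of_eq_of_le (Finset.sum_congr rfl fun v _ => ?_) key
  simp only [ha, hb, hc, hd]
  ring

/-- Subadditivity of entropy. -/
theorem infH_prodMk_le_add {Ω α β : Type*} [MeasurableSpace Ω]
    [Fintype α] [MeasurableSpace α] [MeasurableSingletonClass α]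
    [Fintype β] [MeasurableSpace β] [MeasurableSingletonClass β]
    (P : Measure Ω) [IsProbabilityMeasure P] {X : Ω → α} {Y : Ω → β}
    (hX : Measurable X) (hY : Measurable Y) :
    infH P (fun ω => (X ω, Y ω)) ≤ infH P X + infH P Y := by
  have h := infH_submodular P hX hY (measurable_const (a := ()))
  have h0 : infH P (fun _ : Ω => ()) = 0 := by simp [infH]
  have h1 := infH_comp_le P hX (fun x => (x, ()))
  have h2 := infH_comp_le P hY (fun y => (y, ()))
  have h3 := infH_comp_le P (hX.prodMk (hY.prodMk (measurable_const (a := ()))))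
    (fun v => (v.1, v.2.1))
  linarith

/-- **Corollary 2.** For random variables `S, Z, W, U` on a common probability
space (with `Z` the semantic and `W` the task), if `I(U;S) ≤ ε` then
`I(U;W) ≤ ε + H(Z|S) + H(W) − I(Z;W)`.  In particular, if the semantic satisfies the design
constraints `γ₁ ≤ I(Z;W)` and `H(Z) ≤ γ₃`, then `I(U;W) ≤ ε + γ₃ − γ₁ + H(W)`. -/
theorem utility_upper_bound_design_constraints
    {Ω : Type} [MeasurableSpace Ω] (P : Measure Ω) [IsProbabilityMeasure P]
    {σ ζ τ υ : Type} [Fintype σ] [MeasurableSpace σ] [MeasurableSingletonClass σ]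
    [Fintype ζ] [MeasurableSpace ζ] [MeasurableSingletonClass ζ]
    [Fintype τ] [MeasurableSpace τ] [MeasurableSingletonClass τ]
    [Fintype υ] [MeasurableSpace υ] [MeasurableSingletonClass υ]
    (S : Ω → σ) (Z : Ω → ζ) (W : Ω → τ) (U : Ω → υ)
    (hS : Measurable S) (hZ : Measurable Z) (hW : Measurable W) (hU : Measurable U)
    {ε γ₁ γ₃ : ℝ} (hγ₁ : 0 ≤ γ₁) (hγ₃ : 0 ≤ γ₃)
    (hleak : infMI P U S ≤ ε) :
    infMI P U W ≤ ε + infCondH P Z S + infH P W - infMI P Z W ∧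
    (γ₁ ≤ infMI P Z W → infH P Z ≤ γ₃ →
      infMI P U W ≤ ε + γ₃ - γ₁ + infH P W) := by
  have h1 := infH_submodular P hZ hU hW
  have h2 := infH_submodular P (hU.prodMk hW) hS hZ
  have h3 := infH_comp_le P ((hU.prodMk hW).prodMk (hS.prodMk hZ)) (fun v => (v.1.1, v.2.1))
  have h4 := infH_comp_le P (hZ.prodMk (hU.prodMk hW)) (fun v => ((v.2.1, v.2.2), v.1))
  have h5 := infH_comp_le P (hZ.prodMk hS) (fun v => (v.2, v.1))
  have h6 := infH_prodMk_le_add P hZ hS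
  simp only [infMI, infCondH] at *
  constructor
  · linarith
  · intro h7 h8
    linarith
end
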